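/- Assume that the exponent δ of ψ satisfies δ > 1. Then almost surely the extinction time T_0 is finite and limsup_{t → 0+} Y_{(T_0 − t)^−} · φ⁻¹(t) / log log φ⁻¹(t) = 1. -/

import Mathlib

open MeasureTheory Filter Set Topology
open scoped ENNReal

/-! ### Growth of the branching mechanism and of `φ` -/

lemma exp_neg_two_mul_sub_le {z : ℝ} (hz : 0 ≤ z) :
    Real.exp (-(2 * z)) - 1 + 2 * z ≤ 4 * (Real.exp (-z) - 1 + z) := by
  have hd : ∀ y : ℝ, HasDerivAt
      (fun y => 4 * (Real.exp (-y) - 1 + y) - (Real.exp (-(2 * y)) - 1 + 2 * y))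
      (2 * (1 - Real.exp (-y)) ^ 2) y := by
    intro y
    have h1 : HasDerivAt (fun y : ℝ => Real.exp (-y)) (Real.exp (-y) * (-1)) y :=
      (hasDerivAt_neg y).exp
    have h2 : HasDerivAt (fun y : ℝ => Real.exp (-(2 * y))) (Real.exp (-(2 * y)) * (-(2 * 1))) y :=
      (((hasDerivAt_id y).const_mul 2).neg).exp
    refine ((((h1.sub_const 1).add (hasDerivAt_id y)).const_mul 4).sub
      ((h2.sub_const 1).add ((hasDerivAt_id y).const_mul 2))).congr_deriv ?_
    have : Real.exp (-(2 * y)) = Real.exp (-y) ^ 2 := by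
      rw [← Real.exp_nat_mul]; congr 1; push_cast; ring
    rw [this]; ring
  have hm := monotone_of_hasDerivAt_nonneg hd (fun y => by positivity)
  have := hm hz
  simp at this
  linarith

lemma exp_neg_sub_le_sq {z : ℝ} (hz : 0 ≤ z) : Real.exp (-z) - 1 + z ≤ z ^ 2 := by
  have h1 : 1 + z ≤ Real.exp z := by linarith [Real.add_one_le_exp z]
  have h2 : Real.exp (-z) ≤ 1 - z + z ^ 2 := by
    rw [Real.exp_neg, inv_le_comm₀ (Real.exp_pos _) (by nlinarith)]
    refine le_trans ?_ h1
    rw [inv_le_iff_one_le_mul₀ (by nlinarith)]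
    nlinarith [pow_nonneg hz 3]
  linarith

/-- The integrand of the jump part of a branching mechanism. -/
noncomputable def jumpIntegrand (l x : ℝ) : ℝ :=
  Real.exp (-l * x) - 1 + l * x * Set.indicator (Set.Iio 1) (fun _ => (1 : ℝ)) x

lemma jumpIntegrand_two_mul_le {l x : ℝ} (hl : 0 ≤ l) (hx : 0 < x) :
    jumpIntegrand (2 * l) x ≤ 4 * jumpIntegrand l x + 4 * min 1 (x ^ 2) := by
  unfold jumpIntegrand
  rcases lt_or_ge x 1 with h | h
  · rw [indicator_of_mem (by simpa using h)]
    have := exp_neg_two_mul_sub_le (mul_nonneg hl hx.le)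
    have h2 : 0 ≤ min 1 (x ^ 2) := by positivity
    rw [show -(2 * l) * x = -(2 * (l * x)) by ring, show -l * x = -(l * x) by ring]
    linarith
  · rw [indicator_of_notMem (by simpa using h), min_eq_left (by nlinarith)]
    have h1 : Real.exp (-(2 * l) * x) ≤ 1 := Real.exp_le_one_iff.2 (by nlinarith)
    have h2 := Real.exp_pos (-l * x)
    linarith

lemma abs_jumpIntegrand_le {l x : ℝ} (hl : 0 ≤ l) (hx : 0 < x) :
    |jumpIntegrand l x| ≤ (l ^ 2 + 1) * min 1 (x ^ 2) := by
  unfold jumpIntegrand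
  rcases lt_or_ge x 1 with h | h
  · rw [indicator_of_mem (by simpa using h), min_eq_right (by nlinarith),
      show -l * x = -(l * x) by ring, abs_of_nonneg]
    · nlinarith [exp_neg_sub_le_sq (mul_nonneg hl hx.le)]
    · linarith [Real.add_one_le_exp (-(l * x))]
  · rw [indicator_of_notMem (by simpa using h), min_eq_left (by nlinarith)]
    have h1 : Real.exp (-l * x) ≤ 1 := Real.exp_le_one_iff.2 (by nlinarith)
    have h2 := Real.exp_pos (-l * x)
    rw [abs_le]; constructor <;> nlinarith

lemma branchingMechanism_two_mul_le {ψ : ℝ → ℝ} {a b : ℝ} {ν : Measure ℝ}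
    (hνsupp : ν (Set.Iic 0) = 0)
    (hνint : ∫⁻ x, ENNReal.ofReal (min 1 (x ^ 2)) ∂ν ≠ ⊤)
    (hψform : ∀ l : ℝ, 0 ≤ l → ψ l = a * l + b * l ^ 2 + ∫ x, jumpIntegrand l x ∂ν) :
    ∃ K : ℝ, 0 ≤ K ∧ ∀ l : ℝ, 1 ≤ l → ψ (2 * l) ≤ 4 * ψ l + K * l := by
  have hpos : ∀ᵐ x ∂ν, 0 < x := by
    rw [ae_iff]; convert hνsupp using 2; ext; simp
  have hmin : Integrable (fun x : ℝ => min 1 (x ^ 2)) ν := by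
    refine ⟨by fun_prop, ?_⟩
    rw [hasFiniteIntegral_iff_ofReal (Eventually.of_forall fun x => by positivity)]
    exact hνint.lt_top
  have hint : ∀ l : ℝ, 0 ≤ l → Integrable (jumpIntegrand l) ν := by
    intro l hl
    refine (hmin.const_mul (l ^ 2 + 1)).mono' ?_ ?_
    · have : Measurable (jumpIntegrand l) := by
        unfold jumpIntegrand
        have : Measurable ((Iio (1 : ℝ)).indicator fun _ => (1 : ℝ)) :=
          measurable_const.indicator measurableSet_Iio
        fun_prop
      exact this.aestronglyMeasurable
    · filter_upwards [hpos] with x hx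
      exact abs_jumpIntegrand_le hl hx
  set K := ∫ x, min 1 (x ^ 2) ∂ν with hK
  have hK0 : 0 ≤ K := integral_nonneg fun x => by positivity
  refine ⟨2 * |a| + 4 * K, by positivity, fun l hl => ?_⟩
  have hl0 : 0 ≤ l := by linarith
  have h1 : ∫ x, jumpIntegrand (2 * l) x ∂ν ≤ 4 * ∫ x, jumpIntegrand l x ∂ν + 4 * K := by
    rw [← integral_const_mul, hK, ← integral_const_mul,
      ← integral_add ((hint l hl0).const_mul 4) (hmin.const_mul 4)]
    refine integral_mono_ae (hint _ (by positivity))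
      (((hint l hl0).const_mul 4).add (hmin.const_mul 4)) ?_
    filter_upwards [hpos] with x hx
    exact jumpIntegrand_two_mul_le hl0 hx
  rw [hψform _ hl0, hψform _ (by positivity : 0 ≤ 2 * l)]
  have h2 : -(a * l) ≤ |a| * l := by nlinarith [neg_abs_le a]
  nlinarith

/-- Upper doubling from the polynomial lower growth. -/
lemma exists_two_mul_le_of_growth {ψ : ℝ → ℝ} {K c Q : ℝ} (hψ1 : 0 < ψ 1) (hK : 0 ≤ K)
    (hψ2 : ∀ l : ℝ, 1 ≤ l → ψ (2 * l) ≤ 4 * ψ l + K * l) (hc : 1 < c) (hQ : 0 < Q)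
    (hgrow : ∀ u v : ℝ, 1 ≤ u → u ≤ v → Q * ψ u * u ^ (-c) ≤ ψ v * v ^ (-c)) :
    ∃ C : ℝ, 0 < C ∧ ∀ l : ℝ, 1 ≤ l → ψ (2 * l) ≤ C * ψ l := by
  refine ⟨4 + K / (Q * ψ 1), by positivity, fun l hl => ?_⟩
  have hl0 : 0 < l := by linarith
  have h1 := hgrow 1 l le_rfl hl
  rw [Real.one_rpow, mul_one, Real.rpow_neg hl0.le, ← div_eq_mul_inv,
    le_div_iff₀ (Real.rpow_pos_of_pos hl0 _)] at h1
  have h2 : l ≤ l ^ c := Real.self_le_rpow_of_one_le hl hc.le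
  have h3 : Q * ψ 1 * l ≤ ψ l := le_trans (by gcongr) h1
  have h4 : K * l ≤ K / (Q * ψ 1) * ψ l := by
    rw [div_mul_eq_mul_div, le_div_iff₀ (by positivity)]
    nlinarith
  linarith [hψ2 l hl]

section

variable {ψ φ : ℝ → ℝ} {c Q : ℝ}

lemma tail_integral_le_of_growth (hψpos : ∀ u : ℝ, 0 < u → 0 < ψ u)
    (hGrey : ∀ t : ℝ, 0 < t → IntegrableOn (fun u => (ψ u)⁻¹) (Set.Ioi t))
    (hφ : ∀ t : ℝ, 0 < t → φ t = ∫ u in Set.Ioi t, (ψ u)⁻¹) (hc : 1 < c) (hQ : 0 < Q)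
    (hgrow : ∀ u v : ℝ, 1 ≤ u → u ≤ v → Q * ψ u * u ^ (-c) ≤ ψ v * v ^ (-c))
    {u : ℝ} (hu : 1 ≤ u) : φ u ≤ u / (Q * (c - 1) * ψ u) := by
  have hu0 : 0 < u := by linarith
  have hψu := hψpos u hu0
  have hint : IntegrableOn (fun v : ℝ => (u ^ c / (Q * ψ u)) * v ^ (-c)) (Ioi u) :=
    (integrableOn_Ioi_rpow_of_lt (by linarith) hu0).const_mul _
  have hval : ∫ v in Ioi u, (u ^ c / (Q * ψ u)) * v ^ (-c) = u / (Q * (c - 1) * ψ u) := by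
    rw [integral_const_mul, integral_Ioi_rpow_of_lt (by linarith) hu0]
    have h1 : u ^ c * u ^ (-c + 1) = u := by
      rw [← Real.rpow_add hu0]; simp
    have h2 : (-c + 1) ≠ 0 := by linarith
    have h3 : (c - 1) ≠ 0 := by linarith
    have h4 : -u ^ (-c + 1) / (-c + 1) = u ^ (-c + 1) / (c - 1) := by
      rw [div_eq_div_iff h2 h3]; ring
    rw [h4, div_mul_div_comm, h1]
    congr 1; ring
  rw [hφ u hu0, ← hval]
  refine setIntegral_mono_on (hGrey u hu0) hint measurableSet_Ioi fun v hv => ?_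
  have hv0 : 0 < v := hu0.trans hv
  have h := hgrow u v hu (le_of_lt hv)
  have hψv := hψpos v hv0
  rw [Real.rpow_neg hu0.le] at h
  have huc := Real.rpow_pos_of_pos hu0 c
  rw [inv_le_iff_one_le_mul₀ hψv]
  calc (1 : ℝ) = (u ^ c / (Q * ψ u)) * (Q * ψ u * (u ^ c)⁻¹) := by field_simp
    _ ≤ (u ^ c / (Q * ψ u)) * (ψ v * v ^ (-c)) := by gcongr
    _ = _ := by ring

/-- Shrinking the argument of `φ` by a fixed factor increases `φ` by a fixed factor. -/
lemma exists_one_add_mul_le_tail (hψpos : ∀ u : ℝ, 0 < u → 0 < ψ u)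
    (hGrey : ∀ t : ℝ, 0 < t → IntegrableOn (fun u => (ψ u)⁻¹) (Set.Ioi t))
    (hφ : ∀ t : ℝ, 0 < t → φ t = ∫ u in Set.Ioi t, (ψ u)⁻¹) (hc : 1 < c) (hQ : 0 < Q)
    (hgrow : ∀ u v : ℝ, 1 ≤ u → u ≤ v → Q * ψ u * u ^ (-c) ≤ ψ v * v ^ (-c))
    {θ : ℝ} (hθ0 : 0 < θ) (hθ1 : θ < 1) :
    ∃ κ : ℝ, 0 < κ ∧ ∀ u : ℝ, 1 ≤ θ * u → (1 + κ) * φ u ≤ φ (θ * u) := by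
  have hc1 : 0 < c - 1 := by linarith
  have hθ' : 0 < 1 - θ := by linarith
  refine ⟨(1 - θ) * Q ^ 2 * (c - 1), by positivity, fun u hu => ?_⟩
  have hu0 : 0 < u := by
    by_contra h
    nlinarith
  have hu1 : θ * u ≤ u := by nlinarith
  have hθu : 0 < θ * u := by positivity
  have hψu := hψpos u hu0
  have hsub : Ioc (θ * u) u ⊆ Ioi (θ * u) := Ioc_subset_Ioi_self
  have hsplit : φ (θ * u) = (∫ v in Ioc (θ * u) u, (ψ v)⁻¹) + φ u := by
    rw [hφ _ hθu, hφ _ hu0, ← setIntegral_union (Ioc_disjoint_Ioi le_rfl) measurableSet_Ioi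
      ((hGrey _ hθu).mono_set hsub) (hGrey _ hu0), Ioc_union_Ioi_eq_Ioi hu1]
  have hlow : (1 - θ) * u * (Q / ψ u) ≤ ∫ v in Ioc (θ * u) u, (ψ v)⁻¹ := by
    have h1 : ∫ v in Ioc (θ * u) u, (Q / ψ u) = (1 - θ) * u * (Q / ψ u) := by
      rw [setIntegral_const, Real.volume_real_Ioc_of_le hu1, smul_eq_mul]; ring
    rw [← h1]
    refine setIntegral_mono_on (by simp) ((hGrey _ hθu).mono_set hsub)
      measurableSet_Ioc fun v hv => ?_
    have hv0 : 0 < v := hθu.trans hv.1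
    have hψv := hψpos v hv0
    have h := hgrow v u (hu.trans hv.1.le) hv.2
    rw [Real.rpow_neg hu0.le, Real.rpow_neg hv0.le, ← div_eq_mul_inv, ← div_eq_mul_inv,
      div_le_div_iff₀ (Real.rpow_pos_of_pos hv0 _) (Real.rpow_pos_of_pos hu0 _)] at h
    have hle : v ^ c ≤ u ^ c := Real.rpow_le_rpow hv0.le hv.2 (by linarith)
    have h3 : Q * ψ v ≤ ψ u := by
      have hupos := Real.rpow_pos_of_pos hu0 c
      refine le_of_mul_le_mul_right (h.trans ?_) hupos
      gcongr
    rw [div_le_iff₀ hψu, inv_mul_eq_div, le_div_iff₀ hψv]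
    exact h3
  have htail := tail_integral_le_of_growth hψpos hGrey hφ hc hQ hgrow (hu.trans hu1)
  rw [hsplit]
  have : (1 - θ) * Q ^ 2 * (c - 1) * φ u ≤ (1 - θ) * u * (Q / ψ u) := by
    calc _ ≤ (1 - θ) * Q ^ 2 * (c - 1) * (u / (Q * (c - 1) * ψ u)) := by gcongr
      _ = _ := by field_simp
  linarith

lemma tail_half_le {C : ℝ} (hψpos : ∀ u : ℝ, 0 < u → 0 < ψ u)
    (hGrey : ∀ t : ℝ, 0 < t → IntegrableOn (fun u => (ψ u)⁻¹) (Set.Ioi t))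
    (hφ : ∀ t : ℝ, 0 < t → φ t = ∫ u in Set.Ioi t, (ψ u)⁻¹)
    (hψ2 : ∀ l : ℝ, 1 ≤ l → ψ (2 * l) ≤ C * ψ l) {u : ℝ} (hu : 2 ≤ u) :
    φ (u / 2) ≤ C * φ u := by
  have hu0 : 0 < u := by linarith
  have hsub : ∫ w in Ioi u, (ψ (1 / 2 * w))⁻¹ = 2 * φ (u / 2) := by
    rw [integral_comp_mul_left_Ioi (fun v => (ψ v)⁻¹) u (by norm_num : (0 : ℝ) < 1 / 2),
      hφ _ (by positivity), smul_eq_mul,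
      one_div_mul_eq_div]
    norm_num
  have hint : IntegrableOn (fun w => (ψ (1 / 2 * w))⁻¹) (Ioi u) := by
    rw [integrableOn_Ioi_comp_mul_left_iff (fun v => (ψ v)⁻¹) u (by norm_num : (0 : ℝ) < 1 / 2)]
    exact hGrey _ (by positivity)
  have hle : ∫ w in Ioi u, (ψ (1 / 2 * w))⁻¹ ≤ ∫ w in Ioi u, C * (ψ w)⁻¹ := by
    refine setIntegral_mono_on hint ((hGrey u hu0).const_mul C) measurableSet_Ioi fun w hw => ?_
    have hw : u < w := hw
    have h := hψ2 (1 / 2 * w) (by linarith)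
    rw [show 2 * (1 / 2 * w) = w by ring] at h
    have h1 := hψpos w (by linarith)
    have h2 := hψpos (1 / 2 * w) (by linarith)
    rw [inv_le_iff_one_le_mul₀ h2, mul_assoc, mul_comm _ (ψ _), ← mul_assoc, ← div_eq_mul_inv,
      le_div_iff₀ h1, one_mul]
    exact h
  rw [hsub, integral_const_mul, ← hφ u hu0] at hle
  have hpos : 0 ≤ φ (u / 2) := by
    rw [hφ _ (by positivity)]
    exact setIntegral_nonneg measurableSet_Ioi fun v hv =>
      (inv_pos.2 (hψpos v ((by positivity : 0 < u / 2).trans hv))).le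
  linarith

end

/-! ### Decreasing bijections of the half-line -/

/-- `φ` and `q` restrict to mutually inverse strictly decreasing bijections of `(0, ∞)`. -/
structure DecreasingInverses (φ q : ℝ → ℝ) : Prop where
  anti : StrictAntiOn φ (Ioi 0)
  pos_left : ∀ t, 0 < t → 0 < φ t
  pos_right : ∀ s, 0 < s → 0 < q s
  inv_left : ∀ t, 0 < t → q (φ t) = t
  inv_right : ∀ s, 0 < s → φ (q s) = s

namespace DecreasingInverses

variable {φ q : ℝ → ℝ}

lemma symm (h : DecreasingInverses φ q) : DecreasingInverses q φ where
  anti s hs t ht hst := by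
    have hs' := h.pos_right s hs
    have ht' := h.pos_right t ht
    by_contra hle
    have := h.anti.antitoneOn hs' ht' (not_lt.1 hle)
    rw [h.inv_right s hs, h.inv_right t ht] at this
    exact absurd hst (not_lt.2 this)
  pos_left := h.pos_right
  pos_right := h.pos_left
  inv_left := h.inv_right
  inv_right := h.inv_left

lemma le_of_le (h : DecreasingInverses φ q) {s t : ℝ} (hs : 0 < s) (hst : s ≤ t) : φ t ≤ φ s :=
  h.anti.antitoneOn hs (hs.trans_le hst) hst

lemma tendsto_atTop (h : DecreasingInverses φ q) : Tendsto φ atTop (𝓝 0) := by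
  rw [Metric.tendsto_atTop]
  intro ε hε
  refine ⟨q (ε / 2), fun t ht => ?_⟩
  have hq := h.pos_right (ε / 2) (by positivity)
  have h1 := h.le_of_le hq ht
  rw [h.inv_right _ (by positivity)] at h1
  have h2 := h.pos_left t (hq.trans_le ht)
  rw [Real.dist_eq, sub_zero, abs_of_pos h2]
  linarith

lemma tendsto_nhdsGT_zero (h : DecreasingInverses φ q) : Tendsto φ (𝓝[>] 0) atTop := by
  rw [Filter.tendsto_atTop]
  intro b
  have hb : 0 < max b 1 := by positivity
  filter_upwards [Ioo_mem_nhdsGT (h.pos_right _ hb)] with t ht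
  have := h.le_of_le ht.1 ht.2.le
  rw [h.inv_right _ hb] at this
  exact (le_max_left _ _).trans this

lemma continuousAt (h : DecreasingInverses φ q) {s : ℝ} (hs : 0 < s) : ContinuousAt φ s := by
  have hm : MonotoneOn (fun t => -φ t) (Ioi 0) := fun a ha b _ hab => neg_le_neg (h.le_of_le ha hab)
  have himg : (fun t => -φ t) '' Ioi 0 ∈ 𝓝 (-φ s) := by
    refine mem_of_superset (Iio_mem_nhds (neg_lt_zero.2 (h.pos_left s hs))) fun y hy => ?_
    have hy' : 0 < -y := neg_pos.2 hy
    exact ⟨q (-y), h.pos_right _ hy', by simp [h.inv_right _ hy']⟩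
  exact (continuousAt_of_monotoneOn_of_image_mem_nhds hm (Ioi_mem_nhds hs) himg).neg.congr
    (Eventually.of_forall fun t => neg_neg _)

end DecreasingInverses

/-- The two-sided regularity at infinity of the tail integral `φ` that the limit theorem uses. -/
structure RegularTail (φ q : ℝ → ℝ) : Prop extends DecreasingInverses φ q where
  gap : ∀ θ, 0 < θ → θ < 1 → ∃ κ, 0 < κ ∧ ∀ u, 1 ≤ θ * u → (1 + κ) * φ u ≤ φ (θ * u)
  doubling : ∃ C, ∀ u, 2 ≤ u → φ (u / 2) ≤ C * φ u

namespace RegularTail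

variable {φ q : ℝ → ℝ}

lemma exists_le_mul_of_mul_le (h : RegularTail φ q) {κ : ℝ} (hκ : 0 < κ) :
    ∃ R, 1 ≤ R ∧ ∀ u v, 1 ≤ u → R * u ≤ v → φ v ≤ κ * φ u := by
  obtain ⟨k, hk, hgap⟩ := h.gap (1 / 2) (by norm_num) (by norm_num)
  have hiter : ∀ (j : ℕ) (u : ℝ), 1 ≤ u → (1 + k) ^ j * φ (2 ^ j * u) ≤ φ u := by
    intro j u hu
    induction j with
    | zero => simp
    | succ j ih =>
      have h1 : (1 : ℝ) ≤ 2 ^ j * u := one_le_mul_of_one_le_of_one_le (one_le_pow₀ (by norm_num)) hu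
      have h2 := hgap (2 ^ (j + 1) * u) (by rw [pow_succ]; linarith)
      rw [show (1 / 2 : ℝ) * (2 ^ (j + 1) * u) = 2 ^ j * u by ring] at h2
      calc _ = (1 + k) ^ j * ((1 + k) * φ (2 ^ (j + 1) * u)) := by ring
        _ ≤ (1 + k) ^ j * φ (2 ^ j * u) := by gcongr
        _ ≤ _ := ih
  obtain ⟨j, hj⟩ := pow_unbounded_of_one_lt (1 / κ) (by linarith : 1 < 1 + k)
  refine ⟨2 ^ j, one_le_pow₀ (by norm_num), fun u v hu hv => ?_⟩
  have hu0 : 0 < u := by linarith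
  have h1 := h.le_of_le (by positivity : 0 < 2 ^ j * u) hv
  have h2 := hiter j u hu
  have h3 := h.pos_left v ((by positivity : 0 < 2 ^ j * u).trans_le hv)
  rw [div_lt_iff₀ hκ] at hj
  have h4 : 0 < (1 + k) ^ j := by positivity
  have h5 : (1 + k) ^ j * φ v ≤ φ u := le_trans (by gcongr) h2
  calc φ v = 1 * φ v := (one_mul _).symm
    _ ≤ ((1 + k) ^ j * κ) * φ v := by gcongr
    _ = κ * ((1 + k) ^ j * φ v) := by ring
    _ ≤ κ * φ u := by gcongr

lemma exists_mul_le (h : RegularTail φ q) {η : ℝ} (hη : 0 < η) :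
    ∃ C Λ, 0 < Λ ∧ ∀ u, Λ ≤ u → φ (η * u) ≤ C * φ u := by
  obtain ⟨C, hC⟩ := h.doubling
  have hC0 : 0 ≤ C := by
    by_contra hneg
    have h1 := hC 2 le_rfl
    have h2 := h.pos_left (2 / 2) (by norm_num)
    have h3 := h.pos_left 2 (by norm_num)
    nlinarith
  have hiter : ∀ (j : ℕ) (u : ℝ), 2 ^ j ≤ u → φ (u / 2 ^ j) ≤ C ^ j * φ u := by
    intro j u hu
    induction j with
    | zero => simp
    | succ j ih =>
      have hp : (0 : ℝ) < 2 ^ j := by positivity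
      rw [pow_succ] at hu
      have h2 := hC (u / 2 ^ j) (by rw [le_div_iff₀ hp]; linarith)
      rw [div_div, ← pow_succ] at h2
      calc _ ≤ C * φ (u / 2 ^ j) := h2
        _ ≤ C * (C ^ j * φ u) := by gcongr; exact ih (by linarith)
        _ = _ := by ring
  obtain ⟨j, hj⟩ := pow_unbounded_of_one_lt (1 / η) (by norm_num : (1 : ℝ) < 2)
  refine ⟨C ^ j, 2 ^ j, by positivity, fun u hu => ?_⟩
  have hu0 : 0 < u := lt_of_lt_of_le (by positivity) hu
  refine le_trans (h.le_of_le (by positivity) ?_) (hiter j u hu)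
  rw [div_lt_iff₀ hη] at hj
  rw [div_le_iff₀ (by positivity)]
  nlinarith

end RegularTail

/-! ### Processes with the branching extinction law -/

section Probability

variable {Ω : Type*}

/-- The information carried by the process up to time `t`. -/
abbrev pastSigma (Y : ℝ → Ω → ℝ) (t : ℝ) : MeasurableSpace Ω :=
  ⨆ u ∈ Set.Icc (0 : ℝ) t, MeasurableSpace.comap (Y u) inferInstance

lemma pastSigma_mono (Y : ℝ → Ω → ℝ) {s t : ℝ} (hst : s ≤ t) : pastSigma Y s ≤ pastSigma Y t :=
  biSup_mono fun _ hu => ⟨hu.1, hu.2.trans hst⟩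

lemma measurableSet_pastSigma (Y : ℝ → Ω → ℝ) {s t : ℝ} (hs : 0 ≤ s) (hst : s ≤ t)
    {S : Set ℝ} (hS : MeasurableSet S) : MeasurableSet[pastSigma Y t] (Y s ⁻¹' S) := by
  have h : MeasurableSpace.comap (Y s) inferInstance ≤ pastSigma Y t :=
    le_biSup (fun u => MeasurableSpace.comap (Y u) inferInstance) (⟨hs, hst⟩ : s ∈ Icc (0 : ℝ) t)
  exact h _ ⟨S, hS, rfl⟩

lemma measurableSet_pastSigma_first (Y : ℝ → Ω → ℝ) {S : Set ℝ} (hS : MeasurableSet S)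
    {r : ℕ → ℝ} (hr0 : ∀ i, 0 ≤ r i) (hr : Monotone r) (i : ℕ) :
    MeasurableSet[pastSigma Y (r i)] (Y (r i) ⁻¹' S \ ⋃ j < i, Y (r j) ⁻¹' S) := by
  refine @MeasurableSet.diff _ (pastSigma Y (r i)) _ _ (measurableSet_pastSigma Y (hr0 i) le_rfl hS) ?_
  exact @MeasurableSet.iUnion _ _ (pastSigma Y (r i)) _ _ fun j =>
    @MeasurableSet.iUnion _ _ (pastSigma Y (r i)) _ _ fun hj =>
      measurableSet_pastSigma Y (hr0 j) (hr hj.le) hS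

variable [MeasurableSpace Ω]

/-- A nonnegative right-continuous process which, given its past up to time `t`, vanishes at time
`t + s` with probability `exp (-Y t * q s)`. -/
structure HasExtinctionLaw (P : Measure Ω) (Y : ℝ → Ω → ℝ) (q : ℝ → ℝ) : Prop where
  meas : ∀ t, Measurable (Y t)
  nonneg : ∀ t, 0 ≤ t → ∀ ω, 0 ≤ Y t ω
  right : ∀ ω, ∀ t, 0 ≤ t → ContinuousWithinAt (fun s => Y s ω) (Ici t) t
  real_inter_zero : ∀ t s, 0 ≤ t → 0 < s → ∀ A, MeasurableSet[pastSigma Y t] A →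
    P.real (A ∩ {ω | Y (t + s) ω = 0}) = ∫ ω in A, Real.exp (-(Y t ω * q s)) ∂P

/-- Decomposition of a finite union according to the first set that occurs. -/
lemma sum_real_first_inter {P : Measure Ω} [IsFiniteMeasure P] {E : ℕ → Set Ω}
    (hE : ∀ i, MeasurableSet (E i)) {Z : Set Ω} (hZ : MeasurableSet Z) (n : ℕ) :
    ∑ i ∈ Finset.range n, P.real ((E i \ ⋃ j < i, E j) ∩ Z) =
      P.real ({ω | ∃ i < n, ω ∈ E i} ∩ Z) := by
  rw [← measureReal_biUnion_finset]
  · congr 1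
    ext ω
    simp only [Finset.mem_range, mem_iUnion, mem_inter_iff, Set.mem_sdiff, mem_ofPred_eq, exists_prop,
      not_exists, not_and]
    constructor
    · rintro ⟨i, hi, ⟨h1, -⟩, h2⟩
      exact ⟨⟨i, hi, h1⟩, h2⟩
    · rintro ⟨⟨i, hi, h1⟩, h2⟩
      classical
      have hex : ∃ i, ω ∈ E i := ⟨i, h1⟩
      exact ⟨Nat.find hex, (Nat.find_min' hex h1).trans_lt hi,
        ⟨Nat.find_spec hex, fun j hj => Nat.find_min hex hj⟩, h2⟩
  · intro i _ j _ hij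
    rw [Function.onFun, Set.disjoint_left]
    rintro ω ⟨⟨hi, hi'⟩, -⟩ ⟨⟨hj, hj'⟩, -⟩
    simp only [mem_iUnion, exists_prop, not_exists, not_and] at hi' hj'
    rcases lt_or_gt_of_ne hij with h | h
    · exact hj' i h hi
    · exact hi' j h hj
  · intro i _
    exact ((hE i).diff (MeasurableSet.iUnion fun j => MeasurableSet.iUnion fun _ => hE j)).inter hZ

lemma sum_range_shift_sub_le {f : ℕ → ℝ} (h0 : ∀ k, 0 ≤ f k) (h1 : ∀ k, f k ≤ 1) (K d : ℕ) :
    ∑ k ∈ Finset.range K, (f (k + d) - f k) ≤ d := by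
  induction d with
  | zero => simp
  | succ d ih =>
    have h := Finset.sum_range_sub (fun k => f (k + d)) K
    have h2 : ∑ k ∈ Finset.range K, (f (k + (d + 1)) - f k) =
        ∑ k ∈ Finset.range K, (f (k + 1 + d) - f (k + d)) +
          ∑ k ∈ Finset.range K, (f (k + d) - f k) := by
      rw [← Finset.sum_add_distrib]
      refine Finset.sum_congr rfl fun k _ => ?_
      rw [show k + (d + 1) = k + 1 + d by ring]; ring
    rw [h2, h]
    push_cast
    linarith [h1 (K + d), h0 (0 + d)]

namespace HasExtinctionLaw

variable {P : Measure Ω} {Y : ℝ → Ω → ℝ} {q : ℝ → ℝ}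

lemma pastSigma_le (h : HasExtinctionLaw P Y q) (t : ℝ) : pastSigma Y t ≤ ‹MeasurableSpace Ω› :=
  iSup₂_le fun u _ => (h.meas u).comap_le

lemma measurableSet_zero (h : HasExtinctionLaw P Y q) (t : ℝ) : MeasurableSet {ω | Y t ω = 0} :=
  h.meas t (measurableSet_singleton 0)

variable [IsProbabilityMeasure P]

lemma integrable_exp (h : HasExtinctionLaw P Y q) {t c : ℝ} (ht : 0 ≤ t) (hc : 0 ≤ c) :
    Integrable (fun ω => Real.exp (-(Y t ω * c))) P := by
  have hm := h.meas t
  refine Integrable.of_bound (by fun_prop) 1 (Eventually.of_forall fun ω => ?_)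
  rw [Real.norm_eq_abs, abs_of_pos (Real.exp_pos _), Real.exp_le_one_iff]
  have := mul_nonneg (h.nonneg t ht ω) hc
  linarith

lemma exp_mul_le_real_inter_zero (h : HasExtinctionLaw P Y q) {t s a : ℝ} (ht : 0 ≤ t)
    (hs : 0 < s) (hq : 0 ≤ q s) {A : Set Ω} (hA : MeasurableSet[pastSigma Y t] A)
    (ha : ∀ ω ∈ A, Y t ω ≤ a) :
    Real.exp (-(a * q s)) * P.real A ≤ P.real (A ∩ {ω | Y (t + s) ω = 0}) := by
  rw [h.real_inter_zero t s ht hs A hA, mul_comm, ← smul_eq_mul, ← setIntegral_const]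
  refine setIntegral_mono_on (by simp) (h.integrable_exp ht hq).integrableOn
    (h.pastSigma_le t A hA) fun ω hω => ?_
  have := mul_le_mul_of_nonneg_right (ha ω hω) hq
  exact Real.exp_le_exp.2 (by linarith)

lemma real_inter_zero_le_mul (h : HasExtinctionLaw P Y q) {t s w η y : ℝ} (ht : 0 ≤ t)
    (hs : 0 < s) (hw : 0 < w) (hq : 0 ≤ q s) (hη : 0 ≤ η) (hη1 : η ≤ 1) (hqw : q w = η * q s)
    {A : Set Ω} (hA : MeasurableSet[pastSigma Y t] A) (ha : ∀ ω ∈ A, y ≤ Y t ω) :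
    P.real (A ∩ {ω | Y (t + s) ω = 0}) ≤
      Real.exp (-((1 - η) * (y * q s))) * P.real (A ∩ {ω | Y (t + w) ω = 0}) := by
  rw [h.real_inter_zero t s ht hs A hA, h.real_inter_zero t w ht hw A hA, ← integral_const_mul]
  refine setIntegral_mono_on (h.integrable_exp ht hq).integrableOn
    ((h.integrable_exp ht (by rw [hqw]; positivity)).const_mul _).integrableOn
    (h.pastSigma_le t A hA) fun ω hω => ?_
  rw [← Real.exp_add, hqw]
  refine Real.exp_le_exp.2 ?_
  have := mul_le_mul_of_nonneg_left (mul_le_mul_of_nonneg_right (ha ω hω) hq)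
    (by linarith : 0 ≤ 1 - η)
  nlinarith

/-- Entrance into an open set during an interval is detected along dyadic subdivisions. -/
lemma real_exists_mem_Ico_le (h : HasExtinctionLaw P Y q) {S : Set ℝ} (hS : IsOpen S)
    {t₀ d B : ℝ} (ht : 0 ≤ t₀) (hd : 0 < d) (Z : Set Ω)
    (hB : ∀ m : ℕ, P.real ({ω | ∃ i < 2 ^ m, ω ∈ Y (t₀ + (i : ℕ) * (d / 2 ^ m)) ⁻¹' S} ∩ Z) ≤ B) :
    P.real ({ω | ∃ r ∈ Ico t₀ (t₀ + d), Y r ω ∈ S} ∩ Z) ≤ B := by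
  set E : ℕ → Set Ω :=
    fun m => {ω | ∃ i < 2 ^ m, ω ∈ Y (t₀ + (i : ℕ) * (d / 2 ^ m)) ⁻¹' S} ∩ Z with hE
  have hmono : Monotone E := by
    refine monotone_nat_of_le_succ fun m ω hω => ?_
    obtain ⟨⟨i, hi, hω'⟩, hZ⟩ := hω
    refine ⟨⟨2 * i, by rw [pow_succ]; omega, ?_⟩, hZ⟩
    convert hω' using 3
    push_cast
    rw [pow_succ]; field_simp
  have hsub : {ω | ∃ r ∈ Ico t₀ (t₀ + d), Y r ω ∈ S} ∩ Z ⊆ ⋃ m, E m := by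
    rintro ω ⟨⟨r, ⟨hr0, hr1⟩, hrS⟩, hZ⟩
    have hev := (h.right ω r (ht.trans hr0)).eventually (hS.mem_nhds hrS)
    rw [eventually_nhdsWithin_iff, Metric.eventually_nhds_iff] at hev
    obtain ⟨ε, hε, hev⟩ := hev
    have hδ : 0 < min ε (t₀ + d - r) := lt_min hε (by linarith)
    obtain ⟨m, hm⟩ := pow_unbounded_of_one_lt (d / min ε (t₀ + d - r))
      (by norm_num : (1 : ℝ) < 2)
    have hp : (0 : ℝ) < 2 ^ m := by positivity
    have hstep : d / 2 ^ m < min ε (t₀ + d - r) := by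
      rw [div_lt_iff₀ hδ] at hm
      rw [div_lt_iff₀ hp]; linarith
    have hpos : 0 < d / 2 ^ m := by positivity
    set i := ⌈(r - t₀) / (d / 2 ^ m)⌉₊ with hi
    have hi1 : r - t₀ ≤ i * (d / 2 ^ m) := (div_le_iff₀ hpos).1 (Nat.le_ceil _)
    have hi2 : i * (d / 2 ^ m) < r - t₀ + d / 2 ^ m := by
      have := Nat.ceil_lt_add_one (div_nonneg (sub_nonneg.2 hr0) hpos.le)
      rw [← hi, div_add_one hpos.ne', lt_div_iff₀ hpos] at this
      exact this
    have hlt : i < 2 ^ m := by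
      have h3 : (i : ℝ) * (d / 2 ^ m) < 2 ^ m * (d / 2 ^ m) := by
        rw [mul_div_cancel₀ _ hp.ne']
        linarith [min_le_right ε (t₀ + d - r)]
      exact_mod_cast lt_of_mul_lt_mul_right h3 hpos.le
    refine mem_iUnion.2 ⟨m, ⟨i, hlt, hev ?_ ?_⟩, hZ⟩
    · rw [Real.dist_eq, abs_lt]
      constructor <;> linarith [min_le_left ε (t₀ + d - r)]
    · simp only [mem_Ici]; linarith
  refine (measureReal_mono hsub).trans ?_
  exact le_of_tendsto' ((ENNReal.tendsto_toReal (measure_ne_top _ _)).comp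
    (tendsto_measure_iUnion_atTop hmono)) hB

lemma real_hit_zero_inter_ne_zero (h : HasExtinctionLaw P Y q) (hq : ∀ s, 0 < s → 0 < q s)
    (hqa : ∀ s t, 0 < s → s ≤ t → q t ≤ q s) {p r : ℝ} (hp : 0 < p) (hpr : p < r) :
    P.real ({ω | ∃ s ∈ Ico 0 (0 + p), Y s ω = 0} ∩ {ω | Y r ω = 0}ᶜ) = 0 := by
  have hrp : 0 < r - p := by linarith
  have key : ∀ ε : ℝ, 0 < ε → P.real ({ω | ∃ s ∈ Ico 0 (0 + p), Y s ω = 0} ∩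
      {ω | Y r ω = 0}ᶜ) ≤ 1 - Real.exp (-(ε * q (r - p))) := by
    intro ε hε
    have hS : {ω | ∃ s ∈ Ico 0 (0 + p), Y s ω = 0} ∩ {ω | Y r ω = 0}ᶜ ⊆
        {ω | ∃ s ∈ Ico 0 (0 + p), Y s ω ∈ Iio ε} ∩ {ω | Y r ω = 0}ᶜ := by
      rintro ω ⟨⟨s, hs, hs0⟩, hr⟩
      exact ⟨⟨s, hs, by simpa [hs0] using hε⟩, hr⟩
    refine (measureReal_mono hS).trans ?_
    refine h.real_exists_mem_Ico_le isOpen_Iio le_rfl hp _ fun m => ?_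
    have hpm : 0 < p / 2 ^ m := by positivity
    set g : ℕ → ℝ := fun i => 0 + (i : ℕ) * (p / 2 ^ m) with hg
    have hg0 : ∀ i, 0 ≤ g i := fun i => by simp only [hg]; positivity
    have hgm : Monotone g := fun i j hij => by
      have : (i : ℝ) ≤ j := by exact_mod_cast hij
      simp only [hg]; gcongr
    have hEm : ∀ i, MeasurableSet (Y (g i) ⁻¹' Iio ε) := fun i => h.meas _ measurableSet_Iio
    have hle := measureReal_le_one (μ := P) (s := {ω | ∃ i < 2 ^ m, ω ∈ Y (g i) ⁻¹' Iio ε} ∩ univ)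
    have hexp : Real.exp (-(ε * q (r - p))) ≤ 1 :=
      Real.exp_le_one_iff.2 (by have := mul_pos hε (hq _ hrp); linarith)
    rw [← sum_real_first_inter hEm (h.measurableSet_zero r).compl]
    rw [← sum_real_first_inter hEm MeasurableSet.univ] at hle
    calc _ ≤ ∑ i ∈ Finset.range (2 ^ m), (1 - Real.exp (-(ε * q (r - p)))) *
          P.real ((Y (g i) ⁻¹' Iio ε \ ⋃ j < i, Y (g j) ⁻¹' Iio ε) ∩ univ) := by
          refine Finset.sum_le_sum fun i hi => ?_
          have hgi : g i ≤ p := by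
            have : (i : ℝ) ≤ 2 ^ m := by exact_mod_cast (Finset.mem_range.1 hi).le
            have h2 : (i : ℝ) * (p / 2 ^ m) ≤ 2 ^ m * (p / 2 ^ m) := by gcongr
            rw [mul_div_cancel₀ _ (by positivity)] at h2
            simp only [hg]; linarith
          have hri : 0 < r - g i := by linarith
          have h1 := h.exp_mul_le_real_inter_zero (a := ε) (hg0 i) hri (hq _ hri).le
            (measurableSet_pastSigma_first Y measurableSet_Iio hg0 hgm i)
            (fun ω hω => le_of_lt (mem_Iio.1 hω.1))
          rw [add_sub_cancel] at h1
          rw [inter_univ, ← Set.sdiff_eq]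
          have h2 := measureReal_sdiff_add_inter (μ := P)
            (s := Y (g i) ⁻¹' Iio ε \ ⋃ j < i, Y (g j) ⁻¹' Iio ε) (h.measurableSet_zero r)
          have h3 : Real.exp (-(ε * q (r - p))) ≤ Real.exp (-(ε * q (r - g i))) := by
            have := hqa (r - p) (r - g i) hrp (by linarith)
            gcongr
          have h4 := mul_le_mul_of_nonneg_right h3
            (measureReal_nonneg (μ := P) (s := Y (g i) ⁻¹' Iio ε \ ⋃ j < i, Y (g j) ⁻¹' Iio ε))
          linarith
      _ ≤ 1 - Real.exp (-(ε * q (r - p))) := by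
          rw [← Finset.mul_sum]
          exact mul_le_of_le_one_right (by linarith) hle
  refine le_antisymm ?_ measureReal_nonneg
  have hlim : Tendsto (fun ε : ℝ => 1 - Real.exp (-(ε * q (r - p)))) (𝓝[>] 0) (𝓝 0) := by
    have hc : Continuous fun ε : ℝ => 1 - Real.exp (-(ε * q (r - p))) := by fun_prop
    have := hc.tendsto 0
    simp only [zero_mul, neg_zero, Real.exp_zero, sub_self] at this
    exact this.mono_left nhdsWithin_le_nhds
  exact ge_of_tendsto hlim (by filter_upwards [self_mem_nhdsWithin] with ε hε using key ε hε)

/-- Zero is absorbing. -/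
lemma ae_absorbed (h : HasExtinctionLaw P Y q) (hq : ∀ s, 0 < s → 0 < q s)
    (hqa : ∀ s t, 0 < s → s ≤ t → q t ≤ q s) :
    ∀ᵐ ω ∂P, ∀ s t, 0 ≤ s → s ≤ t → Y s ω = 0 → Y t ω = 0 := by
  have hnull : ∀ p r : ℚ, ∀ᵐ ω ∂P, (0 : ℝ) < p → (p : ℝ) < r →
      (∃ s ∈ Ico (0 : ℝ) (0 + p), Y s ω = 0) → Y r ω = 0 := by
    intro p r
    by_cases hp : (0 : ℝ) < p
    · by_cases hpr : (p : ℝ) < r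
      · have h0 := h.real_hit_zero_inter_ne_zero hq hqa hp hpr
        rw [measureReal_eq_zero_iff] at h0
        rw [ae_iff]
        refine measure_mono_null (fun ω hω => ?_) h0
        simp only [mem_ofPred_eq, not_forall] at hω
        obtain ⟨-, -, h1, h2⟩ := hω
        exact ⟨h1, h2⟩
      · exact Eventually.of_forall fun ω _ hh => absurd hh hpr
    · exact Eventually.of_forall fun ω hh => absurd hh hp
  filter_upwards [ae_all_iff.2 fun p => ae_all_iff.2 (hnull p)] with ω hω s t hs hst hs0
  rcases hst.eq_or_lt with rfl | hlt
  · exact hs0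
  by_contra hne
  have hev := (h.right ω t (hs.trans hst)).eventually (isOpen_ne.mem_nhds hne)
  rw [eventually_nhdsWithin_iff, Metric.eventually_nhds_iff] at hev
  obtain ⟨ε, hε, hev⟩ := hev
  obtain ⟨p, hp1, hp2⟩ := exists_rat_btwn hlt
  obtain ⟨r, hr1, hr2⟩ := exists_rat_btwn (by linarith : t < t + ε)
  refine hev (y := (r : ℝ)) ?_ hr1.le
    (hω p r (hs.trans_lt hp1) (hp2.trans hr1) ⟨s, ⟨hs, by linarith⟩, hs0⟩)
  rw [Real.dist_eq, abs_lt]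
  constructor <;> linarith

end HasExtinctionLaw

namespace HasExtinctionLaw

variable {P : Measure Ω} {Y : ℝ → Ω → ℝ} {q : ℝ → ℝ} [IsProbabilityMeasure P]

lemma real_Ico_inter_zero_le (h : HasExtinctionLaw P Y q) (hq : ∀ s, 0 < s → 0 < q s)
    (hqa : ∀ s t, 0 < s → s ≤ t → q t ≤ q s) {t₀ t d w η y : ℝ} (ht₀ : 0 ≤ t₀) (ht : 0 < t)
    (hd : 0 < d) (hη : 0 < η) (hη1 : η < 1) (hqw : ∀ s, 0 < s → s ≤ t + d →
      ∃ v, 0 < v ∧ v ≤ w ∧ q v = η * q s) (hy : 0 < y) (hw : 0 < w) :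
    P.real ({ω | ∃ r ∈ Ico t₀ (t₀ + d), Y r ω ∈ Ioi y} ∩ {ω | Y (t₀ + d + t) ω = 0}) ≤
      Real.exp (-((1 - η) * (y * q (t + d)))) *
        (P.real {ω | Y (t₀ + d + w) ω = 0} - P.real {ω | Y t₀ ω = 0}) := by
  have habs := h.ae_absorbed hq hqa
  have hmain : Real.exp (-((1 - η) * (y * q (t + d)))) *
        P.real ({ω | Y t₀ ω = 0}ᶜ ∩ {ω | Y (t₀ + d + w) ω = 0}) ≤
      Real.exp (-((1 - η) * (y * q (t + d)))) *
        (P.real {ω | Y (t₀ + d + w) ω = 0} - P.real {ω | Y t₀ ω = 0}) := by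
    gcongr
    have h1 := measureReal_sdiff_add_inter (μ := P) (s := {ω | Y (t₀ + d + w) ω = 0})
      (h.measurableSet_zero t₀)
    have h2 : P.real ({ω | Y (t₀ + d + w) ω = 0} ∩ {ω | Y t₀ ω = 0}) =
        P.real {ω | Y t₀ ω = 0} := by
      refine measureReal_congr ?_
      filter_upwards [habs] with ω hω
      refine propext ⟨fun hh => hh.2, fun hh => ⟨?_, hh⟩⟩
      exact hω t₀ _ ht₀ (by linarith) hh
    rw [inter_comm, ← Set.sdiff_eq]
    linarith
  refine le_trans ?_ hmain
  refine h.real_exists_mem_Ico_le isOpen_Ioi ht₀ hd _ fun m => ?_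
  have hdm : 0 < d / 2 ^ m := by positivity
  set g : ℕ → ℝ := fun i => t₀ + (i : ℕ) * (d / 2 ^ m) with hg
  have hgt : ∀ i, t₀ ≤ g i := fun i => by
    have : 0 ≤ (i : ℝ) * (d / 2 ^ m) := by positivity
    simp only [hg]; linarith
  have hg0 : ∀ i, 0 ≤ g i := fun i => ht₀.trans (hgt i)
  have hgm : Monotone g := fun i j hij => by
    have : (i : ℝ) ≤ j := by exact_mod_cast hij
    simp only [hg]; gcongr
  have hEm : ∀ i, MeasurableSet (Y (g i) ⁻¹' Ioi y) := fun i => h.meas _ measurableSet_Ioi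
  rw [← sum_real_first_inter hEm (h.measurableSet_zero _)]
  have hfin : P.real ({ω | ∃ i < 2 ^ m, ω ∈ Y (g i) ⁻¹' Ioi y} ∩ {ω | Y (t₀ + d + w) ω = 0}) ≤
      P.real ({ω | Y t₀ ω = 0}ᶜ ∩ {ω | Y (t₀ + d + w) ω = 0}) := by
    refine ENNReal.toReal_mono (measure_ne_top _ _) (measure_mono_ae ?_)
    filter_upwards [habs] with ω hω
    rintro ⟨⟨i, -, hi⟩, h0⟩
    refine ⟨fun hz => ?_, h0⟩
    have h1 := hω t₀ (g i) ht₀ (hgt i) hz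
    have h2 : y < Y (g i) ω := hi
    linarith
  refine le_trans ?_ (mul_le_mul_of_nonneg_left hfin (Real.exp_pos _).le)
  rw [← sum_real_first_inter hEm (h.measurableSet_zero _), Finset.mul_sum]
  refine Finset.sum_le_sum fun i hi => ?_
  have hgi : g i < t₀ + d := by
    have : (i : ℝ) < 2 ^ m := by exact_mod_cast (Finset.mem_range.1 hi)
    have h2 : (i : ℝ) * (d / 2 ^ m) < 2 ^ m * (d / 2 ^ m) := by gcongr
    rw [mul_div_cancel₀ _ (by positivity)] at h2
    simp only [hg]; linarith
  have hs : 0 < t₀ + d + t - g i := by linarith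
  have hsd : t₀ + d + t - g i ≤ t + d := by linarith [hgt i]
  obtain ⟨v, hv0, hvw, hv⟩ := hqw _ hs hsd
  have h1 := h.real_inter_zero_le_mul (y := y) (hg0 i) hs hv0 (hq _ hs).le hη.le hη1.le hv
    (measurableSet_pastSigma_first Y measurableSet_Ioi hg0 hgm i)
    (fun ω hω => le_of_lt (mem_Ioi.1 hω.1))
  rw [add_sub_cancel] at h1
  refine h1.trans ?_
  have hqq := hqa _ _ hs hsd
  have hη' : 0 < 1 - η := by linarith
  refine mul_le_mul ?_ ?_ measureReal_nonneg (Real.exp_pos _).le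
  · gcongr
  · refine ENNReal.toReal_mono (measure_ne_top _ _) (measure_mono_ae ?_)
    filter_upwards [habs] with ω hω
    rintro ⟨h2, h3⟩
    exact ⟨h2, hω _ _ (by linarith [hg0 i]) (by linarith) h3⟩

/-- Just before extinction, the process is unlikely to be large. -/
lemma measure_large_before_extinction_le (h : HasExtinctionLaw P Y q) (hq : ∀ s, 0 < s → 0 < q s)
    (hqa : ∀ s t, 0 < s → s ≤ t → q t ≤ q s) {t d w η y : ℝ} (ht : 0 < t)
    (hd : 0 < d) (hη : 0 < η) (hη1 : η < 1) (hqw : ∀ s, 0 < s → s ≤ t + d →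
      ∃ v, 0 < v ∧ v ≤ w ∧ q v = η * q s) (hy : 0 < y) {J : ℕ} (hw : 0 < w) (hJ : w ≤ J * d) :
    P {ω | ∃ r, 0 ≤ r ∧ y < Y r ω ∧ Y (r + t) ω = 0} ≤
      ENNReal.ofReal ((J + 1) * Real.exp (-((1 - η) * (y * q (t + d))))) := by
  have habs := h.ae_absorbed hq hqa
  set B : ℕ → Set Ω := fun k => {ω | ∃ r ∈ Ico (k * d) (k * d + d), Y r ω ∈ Ioi y} ∩
    {ω | Y (k * d + d + t) ω = 0} with hB
  set f : ℕ → ℝ := fun k => P.real {ω | Y (k * d) ω = 0} with hf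
  set e := Real.exp (-((1 - η) * (y * q (t + d)))) with he
  have hsub : P {ω | ∃ r, 0 ≤ r ∧ y < Y r ω ∧ Y (r + t) ω = 0} ≤ P (⋃ k, B k) := by
    refine measure_mono_ae ?_
    filter_upwards [habs] with ω hω
    rintro ⟨r, hr, hyr, hr0⟩
    have hk1 := Nat.floor_le (div_nonneg hr hd.le)
    have hk2 := Nat.lt_floor_add_one (r / d)
    rw [le_div_iff₀ hd] at hk1
    rw [div_lt_iff₀ hd, add_one_mul] at hk2
    exact mem_iUnion.2 ⟨⌊r / d⌋₊, ⟨r, ⟨hk1, hk2⟩, hyr⟩,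
      hω _ _ (by linarith) (by linarith) hr0⟩
  have hBk : ∀ k, P.real (B k) ≤ e * (f (k + (J + 1)) - f k) := by
    intro k
    refine (h.real_Ico_inter_zero_le hq hqa (by positivity) ht hd hη hη1 hqw hy hw).trans ?_
    have : P.real {ω | Y (k * d + d + w) ω = 0} ≤ f (k + (J + 1)) := by
      refine ENNReal.toReal_mono (measure_ne_top _ _) (measure_mono_ae ?_)
      filter_upwards [habs] with ω hω
      intro h2
      refine hω _ _ (by positivity) ?_ h2
      push_cast; linarith
    gcongr
  refine hsub.trans ((measure_iUnion_le _).trans (ENNReal.tsum_le_of_sum_range_le fun K => ?_))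
  have h1 : ∑ k ∈ Finset.range K, P.real (B k) ≤ (J + 1) * e := by
    calc _ ≤ ∑ k ∈ Finset.range K, e * (f (k + (J + 1)) - f k) := Finset.sum_le_sum fun k _ => hBk k
      _ = e * ∑ k ∈ Finset.range K, (f (k + (J + 1)) - f k) := by rw [Finset.mul_sum]
      _ ≤ e * ((J + 1 : ℕ) : ℝ) := by
        gcongr
        exact sum_range_shift_sub_le (fun k => by simp only [hf]; exact measureReal_nonneg)
          (fun k => by simp only [hf]; exact measureReal_le_one) _ _
      _ = _ := by push_cast; ring
  calc _ = ∑ k ∈ Finset.range K, ENNReal.ofReal (P.real (B k)) :=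
        Finset.sum_congr rfl fun k _ => (ofReal_measureReal (measure_ne_top _ _)).symm
    _ = ENNReal.ofReal (∑ k ∈ Finset.range K, P.real (B k)) :=
        (ENNReal.ofReal_sum_of_nonneg fun k _ => measureReal_nonneg).symm
    _ ≤ _ := ENNReal.ofReal_le_ofReal h1

end HasExtinctionLaw

lemma hasExtinctionLaw_of_condExp {P : Measure Ω} [IsProbabilityMeasure P] {Y : ℝ → Ω → ℝ}
    {φ q : ℝ → ℝ} (hφ : DecreasingInverses φ q) (hYmeas : ∀ t : ℝ, Measurable (Y t))
    (hYnonneg : ∀ t : ℝ, 0 ≤ t → ∀ ω, 0 ≤ Y t ω)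
    (hYright : ∀ ω, ∀ t : ℝ, 0 ≤ t → ContinuousWithinAt (fun s => Y s ω) (Set.Ici t) t)
    (hMarkov : ∀ s t : ℝ, 0 ≤ s → 0 ≤ t → ∀ lam : ℝ, 0 < lam →
      P[(fun ω => Real.exp (-lam * Y (t + s) ω)) | pastSigma Y t]
        =ᵐ[P] fun ω => Real.exp (-(Y t ω) * q (s + φ lam))) :
    HasExtinctionLaw P Y q where
  meas := hYmeas
  nonneg := hYnonneg
  right := hYright
  real_inter_zero t s ht hs A hA := by
    have hm : pastSigma Y t ≤ ‹MeasurableSpace Ω› := iSup₂_le fun u _ => (hYmeas u).comap_le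
    have hA' := hm A hA
    have hbound : ∀ c : ℝ, 0 ≤ c → ∀ r : ℝ, 0 ≤ r → ∀ ω, ‖Real.exp (-(Y r ω * c))‖ ≤ 1 := by
      intro c hc r hr ω
      rw [Real.norm_eq_abs, abs_of_pos (Real.exp_pos _), Real.exp_le_one_iff]
      have := mul_nonneg (hYnonneg r hr ω) hc
      linarith
    have hts : 0 ≤ t + s := by linarith
    have hset : ∀ n : ℕ, ∫ ω in A, Real.exp (-(Y (t + s) ω * (n + 1 : ℝ))) ∂P =
        ∫ ω in A, Real.exp (-(Y t ω * q (s + φ (n + 1)))) ∂P := by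
      intro n
      have hn : (0 : ℝ) < n + 1 := by positivity
      have hmY := hYmeas (t + s)
      have hint : Integrable (fun ω => Real.exp (-((n : ℝ) + 1) * Y (t + s) ω)) P := by
        refine Integrable.of_bound (by fun_prop) 1 (Eventually.of_forall fun ω => ?_)
        have := hbound _ hn.le _ hts ω
        rwa [show -(Y (t + s) ω * (n + 1 : ℝ)) = -((n : ℝ) + 1) * Y (t + s) ω by ring] at this
      have h1 := setIntegral_condExp hm hint hA
      rw [setIntegral_congr_ae (g := fun ω => Real.exp (-(Y t ω) * q (s + φ (n + 1)))) hA'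
        ((hMarkov s t hs.le ht _ hn).mono fun ω hω _ => hω)] at h1
      convert h1.symm using 4 <;> ring
    have hnat : Tendsto (fun n : ℕ => (n : ℝ) + 1) atTop atTop :=
      tendsto_atTop_add_const_right _ _ tendsto_natCast_atTop_atTop
    have hq : Tendsto (fun n : ℕ => q (s + φ (n + 1))) atTop (𝓝 (q s)) := by
      have h1 : Tendsto (fun n : ℕ => s + φ ((n : ℝ) + 1)) atTop (𝓝 s) := by
        simpa using (hφ.tendsto_atTop.comp hnat).const_add s
      exact (hφ.symm.continuousAt hs).tendsto.comp h1
    have hL : Tendsto (fun n : ℕ => ∫ ω in A, Real.exp (-(Y (t + s) ω * (n + 1 : ℝ))) ∂P) atTop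
        (𝓝 (∫ ω in A, {ω | Y (t + s) ω = 0}.indicator (fun _ => (1 : ℝ)) ω ∂P)) := by
      refine tendsto_integral_of_dominated_convergence (fun _ => 1) (fun n => ?_)
        (integrable_const _) (fun n => Eventually.of_forall (hbound _ (by positivity) _ hts))
        (Eventually.of_forall fun ω => ?_)
      · have hmY := hYmeas (t + s)
        exact Measurable.aestronglyMeasurable (by fun_prop)
      · by_cases h0 : Y (t + s) ω = 0
        · simp [h0]
        · have hpos : 0 < Y (t + s) ω := lt_of_le_of_ne (hYnonneg _ hts ω) (Ne.symm h0)
          rw [indicator_of_notMem (by simpa using h0)]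
          exact Real.tendsto_exp_neg_atTop_nhds_zero.comp (hnat.const_mul_atTop hpos)
    have hR : Tendsto (fun n : ℕ => ∫ ω in A, Real.exp (-(Y t ω * q (s + φ (n + 1)))) ∂P) atTop
        (𝓝 (∫ ω in A, Real.exp (-(Y t ω * q s)) ∂P)) := by
      refine tendsto_integral_of_dominated_convergence (fun _ => 1) (fun n => ?_)
        (integrable_const _) (fun n => Eventually.of_forall (hbound _ ?_ _ ht))
        (Eventually.of_forall fun ω => ?_)
      · have hmY := hYmeas t
        exact Measurable.aestronglyMeasurable (by fun_prop)
      · exact (hφ.pos_right _ (add_pos hs (hφ.pos_left _ (by positivity)))).le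
      · exact (Real.continuous_exp.tendsto _).comp (hq.const_mul _).neg
    have h0 : MeasurableSet {ω | Y (t + s) ω = 0} := hYmeas _ (measurableSet_singleton 0)
    have heq := tendsto_nhds_unique hL (hR.congr fun n => (hset n).symm)
    rw [← heq, integral_indicator h0, setIntegral_const, smul_eq_mul, mul_one,
      measureReal_restrict_apply' hA', inter_comm]

namespace HasExtinctionLaw

variable {P : Measure Ω} {Y : ℝ → Ω → ℝ} {q : ℝ → ℝ} [IsProbabilityMeasure P]

lemma ae_exists_zero (h : HasExtinctionLaw P Y q) {x : ℝ} (hY0 : ∀ᵐ ω ∂P, Y 0 ω = x)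
    (hq0 : Tendsto q atTop (𝓝 0)) : ∀ᵐ ω ∂P, ∃ t, 0 ≤ t ∧ Y t ω = 0 := by
  have hprob : ∀ s : ℝ, 0 < s → P.real {ω | Y s ω = 0} = Real.exp (-(x * q s)) := by
    intro s hs
    have h1 := h.real_inter_zero 0 s le_rfl hs univ (@MeasurableSet.univ _ (pastSigma Y 0))
    rw [univ_inter, zero_add, setIntegral_univ] at h1
    rw [h1, integral_congr_ae (g := fun _ => Real.exp (-(x * q s)))
      (hY0.mono fun ω hω => by simp only [hω])]
    simp
  set Z : Set Ω := ⋃ n : ℕ, {ω | Y ((n : ℝ) + 1) ω = 0} with hZ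
  have hZm : MeasurableSet Z := MeasurableSet.iUnion fun n => h.measurableSet_zero _
  have hnat : Tendsto (fun n : ℕ => (n : ℝ) + 1) atTop atTop :=
    tendsto_atTop_add_const_right _ _ tendsto_natCast_atTop_atTop
  have hlim : Tendsto (fun n : ℕ => Real.exp (-(x * q (n + 1)))) atTop (𝓝 1) := by
    have := (Real.continuous_exp.tendsto _).comp ((hq0.comp hnat).const_mul x).neg
    simpa [Function.comp_def] using this
  have hZ1 : 1 ≤ P.real Z := by
    refine le_of_tendsto' hlim fun n => ?_
    rw [← hprob _ (by positivity)]
    exact measureReal_mono (subset_iUnion (fun n : ℕ => {ω | Y ((n : ℝ) + 1) ω = 0}) n)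
  have hZc : P Zᶜ = 0 := by
    rw [← measureReal_eq_zero_iff, probReal_compl_eq_one_sub hZm]
    linarith [measureReal_le_one (μ := P) (s := Z)]
  filter_upwards [measure_eq_zero_iff_ae_notMem.1 hZc] with ω hω
  obtain ⟨n, hn⟩ := mem_iUnion.1 (not_not.1 hω)
  exact ⟨n + 1, by positivity, hn⟩

end HasExtinctionLaw

/-! ### The upper bound -/

lemma measure_large_before_extinction_tail_le {P : Measure Ω} [IsProbabilityMeasure P]
    {Y : ℝ → Ω → ℝ} {φ q : ℝ → ℝ} (h : HasExtinctionLaw P Y q) (hR : RegularTail φ q) {ρ η : ℝ}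
    (hρ : 1 < ρ) (hη : 0 < η) (hη1 : η < 1) :
    ∃ (J : ℕ) (Λ : ℝ), 0 < Λ ∧ ∀ l y, Λ ≤ l → 0 < y →
      P {ω | ∃ r, 0 ≤ r ∧ y < Y r ω ∧ Y (r + φ (ρ * l)) ω = 0} ≤
        ENNReal.ofReal ((J + 1) * Real.exp (-((1 - η) * (y * l)))) := by
  have hρ0 : 0 < ρ := by linarith
  obtain ⟨κ, hκ, hgap⟩ := hR.gap ρ⁻¹ (by positivity) (inv_lt_one_of_one_lt₀ hρ)
  obtain ⟨C, Λ, hΛ, hC⟩ := hR.exists_mul_le hη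
  obtain ⟨J, hJ⟩ := exists_nat_ge (C * (1 + κ) / κ)
  refine ⟨J, max Λ 1, by positivity, fun l y hl hy => ?_⟩
  have hl1 : 1 ≤ l := (le_max_right _ _).trans hl
  have hl0 : 0 < l := by linarith
  have hφl := hR.pos_left l hl0
  have ht := hR.pos_left (ρ * l) (by positivity)
  have hg := hgap (ρ * l) (by rw [inv_mul_cancel_left₀ hρ0.ne']; exact hl1)
  rw [inv_mul_cancel_left₀ hρ0.ne'] at hg
  have hd : κ / (1 + κ) * φ l ≤ φ l - φ (ρ * l) := by
    have h1 : φ (ρ * l) ≤ φ l / (1 + κ) := by rw [le_div_iff₀ (by positivity)]; linarith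
    have h2 : κ / (1 + κ) * φ l = φ l - φ l / (1 + κ) := by field_simp; ring
    linarith
  have hd0 : 0 < φ l - φ (ρ * l) := lt_of_lt_of_le (by positivity) hd
  have key := h.measure_large_before_extinction_le hR.pos_right
    (fun s t hs hst => hR.symm.le_of_le hs hst) (t := φ (ρ * l)) (d := φ l - φ (ρ * l))
    (w := φ (η * l)) (η := η) (y := y) (J := J) ht hd0 hη hη1 ?_ hy
    (hR.pos_left _ (by positivity)) ?_
  · rwa [add_sub_cancel, hR.inv_left l hl0] at key
  · intro s hs hsl
    rw [add_sub_cancel] at hsl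
    have hqs := hR.symm.le_of_le hs hsl
    rw [hR.inv_left l hl0] at hqs
    have hqs0 := hR.pos_right s hs
    refine ⟨φ (η * q s), hR.pos_left _ (by positivity), hR.le_of_le (by positivity) (by gcongr),
      hR.inv_left _ (by positivity)⟩
  · have h1 := hC l ((le_max_left _ _).trans hl)
    have h2 : C * φ l = C * (1 + κ) / κ * (κ / (1 + κ) * φ l) := by field_simp
    calc φ (η * l) ≤ C * (1 + κ) / κ * (κ / (1 + κ) * φ l) := by rw [← h2]; exact h1
      _ ≤ J * (κ / (1 + κ) * φ l) := by gcongr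
      _ ≤ J * (φ l - φ (ρ * l)) := by gcongr

lemma ae_eventually_not_large_before_extinction {P : Measure Ω} [IsProbabilityMeasure P]
    {Y : ℝ → Ω → ℝ} {φ q : ℝ → ℝ} (h : HasExtinctionLaw P Y q) (hR : RegularTail φ q) {ρ : ℝ}
    (hρ : 1 < ρ) :
    ∀ᵐ ω ∂P, ∀ᶠ n : ℕ in atTop, ¬ ∃ r, 0 ≤ r ∧
      ρ ^ 2 * Real.log (Real.log (ρ ^ (n + 2))) / ρ ^ n < Y r ω ∧
        Y (r + φ (ρ ^ (n + 1))) ω = 0 := by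
  have hρ0 : 0 < ρ := by linarith
  have hlog := Real.log_pos hρ
  obtain ⟨J, Λ, hΛ, hle⟩ := measure_large_before_extinction_tail_le h hR hρ
    (η := 1 - ρ⁻¹) (by linarith [inv_lt_one_of_one_lt₀ hρ]) (by linarith [inv_pos.2 hρ0])
  have hlarge : ∀ᶠ n : ℕ in atTop, Λ ≤ ρ ^ n ∧ 1 < Real.log (ρ ^ (n + 2)) := by
    refine ((tendsto_pow_atTop_atTop_of_one_lt hρ).eventually_ge_atTop Λ).and ?_
    exact (Real.tendsto_log_atTop.comp ((tendsto_pow_atTop_atTop_of_one_lt hρ).comp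
      (tendsto_add_atTop_nat 2))).eventually_gt_atTop 1
  obtain ⟨N, hN⟩ := eventually_atTop.1 hlarge
  set E : ℕ → Set Ω := fun n => {ω | ∃ r, 0 ≤ r ∧
      ρ ^ 2 * Real.log (Real.log (ρ ^ (n + 2))) / ρ ^ n < Y r ω ∧
        Y (r + φ (ρ ^ (n + 1))) ω = 0} with hE
  have hEle : ∀ n, N ≤ n →
      P (E n) ≤ ENNReal.ofReal ((J + 1) * (((n : ℝ) + 2) * Real.log ρ) ^ (-ρ)) := by
    intro n hn
    obtain ⟨h1, h2⟩ := hN n hn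
    have hll := Real.log_pos h2
    have := hle (ρ ^ n) (ρ ^ 2 * Real.log (Real.log (ρ ^ (n + 2))) / ρ ^ n) h1 (by positivity)
    rw [← pow_succ'] at this
    refine this.trans (ENNReal.ofReal_le_ofReal ?_)
    rw [Real.rpow_def_of_pos (by positivity)]
    have h3 : Real.log (ρ ^ (n + 2)) = ((n : ℝ) + 2) * Real.log ρ := by
      rw [Real.log_pow]; push_cast; ring
    rw [h3]
    refine le_of_eq ?_
    congr 3
    have := pow_pos hρ0 n
    field_simp
    ring
  have hsum : Summable fun n : ℕ => (J + 1 : ℝ) * (((n : ℝ) + 2) * Real.log ρ) ^ (-ρ) := by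
    refine Summable.mul_left _ ?_
    have h1 : Summable fun n : ℕ => Real.log ρ ^ (-ρ) * ((n + 2 : ℕ) : ℝ) ^ (-ρ) :=
      ((summable_nat_add_iff 2).2 (Real.summable_nat_rpow.2 (by linarith))).mul_left _
    refine h1.congr fun n => ?_
    rw [Real.mul_rpow (by positivity) hlog.le]
    push_cast; ring
  have hfin : ∑' n, P (E (n + N)) ≠ ⊤ := by
    refine ne_top_of_le_ne_top ?_ (ENNReal.tsum_le_tsum fun n => hEle (n + N) (by omega))
    rw [← ENNReal.ofReal_tsum_of_nonneg (fun n => by positivity)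
      ((summable_nat_add_iff (f := fun n : ℕ =>
        (J + 1 : ℝ) * (((n : ℝ) + 2) * Real.log ρ) ^ (-ρ)) N).2 hsum)]
    exact ENNReal.ofReal_ne_top
  filter_upwards [ae_eventually_notMem hfin] with ω hω
  obtain ⟨M, hM⟩ := eventually_atTop.1 hω
  filter_upwards [eventually_ge_atTop (M + N)] with n hn
  have := hM (n - N) (by omega)
  rwa [Nat.sub_add_cancel (by omega)] at this

end Probability

section Paths

variable {f : ℝ → ℝ}

/-- A right-continuous path absorbed at zero vanishes exactly from its extinction time on. -/
lemma extinctionTime_spec (hright : ∀ t, 0 ≤ t → ContinuousWithinAt f (Ici t) t)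
    (habs : ∀ s t, 0 ≤ s → s ≤ t → f s = 0 → f t = 0) (hex : ∃ t, 0 ≤ t ∧ f t = 0)
    (h0 : f 0 ≠ 0) :
    0 < sInf {s | 0 ≤ s ∧ f s = 0} ∧ ∀ s, 0 ≤ s → (f s = 0 ↔ sInf {s | 0 ≤ s ∧ f s = 0} ≤ s) := by
  set T := sInf {s | 0 ≤ s ∧ f s = 0} with hT
  have hbdd : BddBelow {s | 0 ≤ s ∧ f s = 0} := ⟨0, fun s hs => hs.1⟩
  have hT0 : 0 ≤ T := Real.sInf_nonneg fun s hs => hs.1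
  have hafter : ∀ s, T < s → f s = 0 := by
    intro s hs
    obtain ⟨r, hr, hrs⟩ := exists_lt_of_csInf_lt hex hs
    exact habs r s hr.1 hrs.le hr.2
  have hfT : f T = 0 := by
    have h1 : Tendsto f (𝓝[>] T) (𝓝 (f T)) := (hright T hT0).mono_left (nhdsWithin_mono _ Ioi_subset_Ici_self)
    have h2 : Tendsto f (𝓝[>] T) (𝓝 0) :=
      tendsto_const_nhds.congr' (by filter_upwards [self_mem_nhdsWithin] with s hs using
        (hafter s hs).symm)
    exact tendsto_nhds_unique h1 h2
  refine ⟨hT0.lt_of_ne fun hne => h0 (by rwa [← hne] at hfT), fun s hs => ⟨fun hfs => ?_, fun hTs => ?_⟩⟩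
  · exact csInf_le hbdd ⟨hs, hfs⟩
  · exact habs T s hT0 hTs hfT

variable {fleft φ q : ℝ → ℝ} {T ρ : ℝ}

lemma eventually_left_limit_le (hφ : DecreasingInverses φ q) (hT : 0 < T)
    (hspec : ∀ s, 0 ≤ s → (f s = 0 ↔ T ≤ s))
    (hleft : ∀ s, 0 < s → Tendsto f (𝓝[<] s) (𝓝 (fleft s))) (hρ : 1 < ρ)
    (hev : ∀ᶠ n : ℕ in atTop, ¬ ∃ r, 0 ≤ r ∧
      ρ ^ 2 * Real.log (Real.log (ρ ^ (n + 2))) / ρ ^ n < f r ∧ f (r + φ (ρ ^ (n + 1))) = 0) :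
    ∀ᶠ t in 𝓝[>] (0 : ℝ), fleft (T - t) * q t / Real.log (Real.log (q t)) ≤ ρ ^ 5 := by
  have hρ0 : 0 < ρ := by linarith
  have hlarge : ∀ᶠ n : ℕ in atTop, 1 < Real.log (ρ ^ (n + 2)) :=
    (Real.tendsto_log_atTop.comp ((tendsto_pow_atTop_atTop_of_one_lt hρ).comp
      (tendsto_add_atTop_nat 2))).eventually_gt_atTop 1
  obtain ⟨N, hN⟩ := eventually_atTop.1 (hev.and hlarge)
  filter_upwards [hφ.symm.tendsto_nhdsGT_zero.eventually_ge_atTop (ρ ^ (N + 2)),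
    Ioo_mem_nhdsGT hT] with t hqt ht
  obtain ⟨m, hm1, hm2⟩ := exists_nat_pow_near ((one_le_pow₀ hρ.le).trans hqt) hρ
  have hNm : N + 2 ≤ m := by
    by_contra hlt
    have : ρ ^ (m + 1) ≤ ρ ^ (N + 2) := pow_le_pow_right₀ hρ.le (by omega)
    linarith
  obtain ⟨n, rfl⟩ : ∃ n, m = n + 2 := ⟨m - 2, by omega⟩
  obtain ⟨hn1, hn2⟩ := hN n (by omega)
  have hq0 := hφ.pos_right t ht.1
  have hll : 0 < Real.log (Real.log (ρ ^ (n + 2))) := Real.log_pos hn2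
  have hmono : Real.log (Real.log (ρ ^ (n + 2))) ≤ Real.log (Real.log (q t)) :=
    Real.log_le_log (by linarith) (Real.log_le_log (by positivity) hm1)
  by_contra! hgt
  refine hn1 ?_
  rw [lt_div_iff₀ (hll.trans_le hmono)] at hgt
  have hlarge : ρ ^ 2 * Real.log (Real.log (ρ ^ (n + 2))) / ρ ^ n < fleft (T - t) := by
    have h1 : ρ ^ 5 * Real.log (Real.log (q t)) / q t < fleft (T - t) := by
      rwa [div_lt_iff₀ hq0]
    refine lt_of_le_of_lt ?_ h1
    have h2 : ρ ^ 2 * Real.log (Real.log (ρ ^ (n + 2))) / ρ ^ n =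
        ρ ^ 5 * Real.log (Real.log (ρ ^ (n + 2))) / ρ ^ (n + 2 + 1) := by
      field_simp
      ring
    have h3 := hll.trans_le hmono
    rw [h2]
    gcongr
  have htφ : t < φ (ρ ^ (n + 1)) := by
    have h1 : ρ ^ (n + 1) < q t := lt_of_lt_of_le (pow_lt_pow_right₀ hρ (by omega)) hm1
    have h2 := hφ.anti (mem_Ioi.2 (by positivity)) (mem_Ioi.2 hq0) h1
    rwa [hφ.inv_right t ht.1] at h2
  have hTt : 0 < T - t := by linarith [ht.2]
  have hlt : max 0 (T - φ (ρ ^ (n + 1))) < T - t := max_lt hTt (by linarith)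
  obtain ⟨r, hr1, hr2⟩ := (((hleft _ hTt).eventually_const_lt hlarge).and
    (Ioo_mem_nhdsLT hlt)).exists
  have hr0 : 0 ≤ r := (le_max_left _ _).trans hr2.1.le
  have hrφ := (le_max_right _ _).trans hr2.1.le
  exact ⟨r, hr0, hr1, (hspec _ (add_nonneg hr0 (hφ.pos_left _ (by positivity)).le)).2 (by linarith)⟩

end Paths

section Probability

variable {Ω : Type*}

/-! ### The lower bound -/

/-- The process observed along the grid of mesh `δ` is at most `a` for the first time at the
`k`-th step. -/
def firstBelow (Y : ℝ → Ω → ℝ) (δ a : ℝ) (k : ℕ) : Set Ω :=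
  Y (k * δ) ⁻¹' Iic a \ ⋃ j < k, Y ((j : ℕ) * δ) ⁻¹' Iic a

lemma mem_firstBelow {Y : ℝ → Ω → ℝ} {δ a : ℝ} {k : ℕ} {ω : Ω} :
    ω ∈ firstBelow Y δ a k ↔ Y (k * δ) ω ≤ a ∧ ∀ j < k, a < Y ((j : ℕ) * δ) ω := by
  simp [firstBelow]

lemma exists_mem_firstBelow_le {Y : ℝ → Ω → ℝ} {δ a : ℝ} {k : ℕ} {ω : Ω}
    (h : Y (k * δ) ω ≤ a) : ∃ l ≤ k, ω ∈ firstBelow Y δ a l := by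
  classical
  have hex : ∃ k : ℕ, Y (k * δ) ω ≤ a := ⟨k, h⟩
  exact ⟨Nat.find hex, Nat.find_min' hex h, mem_firstBelow.2 ⟨Nat.find_spec hex,
    fun j hj => not_le.1 (Nat.find_min hex hj)⟩⟩

lemma firstBelow_unique {Y : ℝ → Ω → ℝ} {δ a : ℝ} {k l : ℕ} {ω : Ω}
    (hk : ω ∈ firstBelow Y δ a k) (hl : ω ∈ firstBelow Y δ a l) : k = l := by
  rw [mem_firstBelow] at hk hl
  rcases lt_trichotomy k l with h | h | h
  · exact absurd hk.1 (not_le.2 (hl.2 k h))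
  · exact h
  · exact absurd hl.1 (not_le.2 (hk.2 l h))

lemma measurableSet_firstBelow (Y : ℝ → Ω → ℝ) {δ a : ℝ} (hδ : 0 ≤ δ) {k l : ℕ} (hkl : k ≤ l) :
    MeasurableSet[pastSigma Y (l * δ)] (firstBelow Y δ a k) :=
  pastSigma_mono Y (by gcongr) _ (measurableSet_pastSigma_first Y measurableSet_Iic
    (r := fun k : ℕ => k * δ) (fun i => by positivity)
    (fun i j hij => by
      have : (i : ℝ) ≤ j := by exact_mod_cast hij
      simp only; gcongr) k)

variable [MeasurableSpace Ω]

namespace HasExtinctionLaw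

variable {P : Measure Ω} {Y : ℝ → Ω → ℝ} {q : ℝ → ℝ} [IsProbabilityMeasure P]

/-- The strong Markov property at the first grid time where the process is at most `a`. -/
lemma exp_mul_le_real_inter_firstBelow (h : HasExtinctionLaw P Y q) {δ a s : ℝ} (hδ : 0 ≤ δ)
    (hs : 0 < s) (hq : 0 ≤ q s) {D : Set Ω}
    (hD : ∀ k : ℕ, MeasurableSet[pastSigma Y (k * δ)] (D ∩ firstBelow Y δ a k))
    (hcov : ∀ᵐ ω ∂P, ∃ k, ω ∈ firstBelow Y δ a k) :
    Real.exp (-(a * q s)) * P.real D ≤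
      P.real (D ∩ {ω | ∃ k : ℕ, ω ∈ firstBelow Y δ a k ∧ Y (k * δ + s) ω = 0}) := by
  have hle : ENNReal.ofReal (Real.exp (-(a * q s))) * P D ≤
      P (D ∩ {ω | ∃ k : ℕ, ω ∈ firstBelow Y δ a k ∧ Y (k * δ + s) ω = 0}) := by
    calc _ ≤ ENNReal.ofReal (Real.exp (-(a * q s))) * P (⋃ k, D ∩ firstBelow Y δ a k) := by
          refine mul_le_mul' le_rfl (measure_mono_ae ?_)
          filter_upwards [hcov] with ω ⟨k, hk⟩ hω
          exact mem_iUnion.2 ⟨k, hω, hk⟩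
      _ ≤ ENNReal.ofReal (Real.exp (-(a * q s))) * ∑' k, P (D ∩ firstBelow Y δ a k) := by
          gcongr
          exact measure_iUnion_le _
      _ = ∑' k, ENNReal.ofReal (Real.exp (-(a * q s))) * P (D ∩ firstBelow Y δ a k) :=
          ENNReal.tsum_mul_left.symm
      _ ≤ ∑' k : ℕ, P ((D ∩ firstBelow Y δ a k) ∩ {ω | Y (k * δ + s) ω = 0}) := by
          refine ENNReal.tsum_le_tsum fun k => ?_
          have h1 := h.exp_mul_le_real_inter_zero (a := a) (by positivity) hs hq (hD k)
            (fun ω hω => (mem_firstBelow.1 hω.2).1)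
          have h2 := ENNReal.ofReal_le_ofReal h1
          rwa [ENNReal.ofReal_mul (Real.exp_pos _).le, ofReal_measureReal (measure_ne_top _ _),
            ofReal_measureReal (measure_ne_top _ _)] at h2
      _ = P (⋃ k : ℕ, (D ∩ firstBelow Y δ a k) ∩ {ω | Y (k * δ + s) ω = 0}) := by
          refine (measure_iUnion (fun k l hkl => ?_) fun k => ?_).symm
          · rw [Function.onFun, Set.disjoint_left]
            rintro ω ⟨⟨-, h1⟩, -⟩ ⟨⟨-, h2⟩, -⟩
            exact hkl (firstBelow_unique h1 h2)
          · exact (h.pastSigma_le _ _ (hD k)).inter (h.measurableSet_zero _)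
      _ ≤ _ := by
          refine measure_mono (iUnion_subset fun k => ?_)
          rintro ω ⟨⟨h1, h2⟩, h3⟩
          exact ⟨h1, k, h2, h3⟩
  have := ENNReal.toReal_mono (measure_ne_top _ _) hle
  rwa [ENNReal.toReal_mul, ENNReal.toReal_ofReal (Real.exp_pos _).le] at this

/-- It is unlikely that at none of the levels `a n`, `N ≤ n < M`, the process dies out
abnormally fast. -/
lemma real_not_fast_extinction_le (h : HasExtinctionLaw P Y q) (hq : ∀ s, 0 < s → 0 < q s)
    (hqa : ∀ s t, 0 < s → s ≤ t → q t ≤ q s) (hex : ∀ᵐ ω ∂P, ∃ t, 0 ≤ t ∧ Y t ω = 0)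
    {a s ρ : ℕ → ℝ} (ha : Antitone a) (ha0 : ∀ n, 0 ≤ a n) (hs : ∀ n, 0 < s n)
    (hρ : ∀ n, 0 < ρ n) {N M : ℕ} (hNM : N ≤ M) (hY0 : ∀ᵐ ω ∂P, a N < Y 0 ω) :
    P.real {ω | ∀ n ∈ Finset.Ico N M,
        ¬ ∃ r, 0 ≤ r ∧ a n < Y r ω ∧ Y (r + (s n + 2 * ρ n)) ω = 0} ≤
      ∏ n ∈ Finset.Ico N M, (1 - Real.exp (-(a n * q (s n)))) +
        ∑ n ∈ Finset.Ico N M, (1 - Real.exp (-(a (n + 1) * q (ρ n)))) := by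
  have habs := h.ae_absorbed hq hqa
  obtain ⟨δ, hδ, hδρ⟩ : ∃ δ : ℝ, 0 < δ ∧ ∀ n ∈ Finset.Ico N M, 2 * δ ≤ ρ n := by
    rcases (Finset.Ico N M).eq_empty_or_nonempty with he | hne
    · exact ⟨1, one_pos, by simp [he]⟩
    · obtain ⟨m, hm, hmin⟩ := Finset.exists_min_image _ ρ hne
      exact ⟨ρ m / 2, half_pos (hρ m), fun n hn => by linarith [hmin n hn]⟩
  have hcov : ∀ n, ∀ᵐ ω ∂P, ∃ k, ω ∈ firstBelow Y δ (a n) k := by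
    intro n
    filter_upwards [habs, hex] with ω hω ⟨t, ht, ht0⟩
    have h1 : Y ((⌈t / δ⌉₊ : ℕ) * δ) ω = 0 :=
      hω t _ ht ((div_le_iff₀ hδ).1 (Nat.le_ceil _)) ht0
    obtain ⟨l, -, hl⟩ := exists_mem_firstBelow_le (h1.le.trans (ha0 n))
    exact ⟨l, hl⟩
  set j : ℕ → ℕ := fun n => ⌈s n / δ⌉₊ with hj
  have hj1 : ∀ n, s n ≤ j n * δ := fun n => (div_le_iff₀ hδ).1 (Nat.le_ceil _)
  have hj2 : ∀ n, j n * δ ≤ s n + δ := fun n => by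
    have := (Nat.ceil_lt_add_one (div_nonneg (hs n).le hδ.le)).le
    rwa [div_add_one hδ.ne', le_div_iff₀ hδ] at this
  set H : ℕ → Set Ω := fun n => {ω | ∃ k l : ℕ, ω ∈ firstBelow Y δ (a n) k ∧ l ≤ k + j n ∧
    Y (l * δ) ω ≤ a (n + 1)} with hH
  set Z : ℕ → Set Ω := fun n => {ω | ∃ k : ℕ, ω ∈ firstBelow Y δ (a (n + 1)) k ∧
    Y (k * δ + ρ n) ω = 0} with hZ
  set D : ℕ → Set Ω := fun n => {ω | ∀ i ∈ Finset.Ico N n, ω ∉ H i} with hD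
  have hYm : ∀ (l k : ℕ) (c : ℝ), l ≤ k → MeasurableSet[pastSigma Y (k * δ)] (Y (l * δ) ⁻¹' Iic c) :=
    fun l k c hlk => measurableSet_pastSigma Y (by positivity) (by gcongr) measurableSet_Iic
  have hDF : ∀ n k : ℕ, MeasurableSet[pastSigma Y (k * δ)] (D n ∩ firstBelow Y δ (a n) k) := by
    intro n k
    have heq : D n ∩ firstBelow Y δ (a n) k = firstBelow Y δ (a n) k ∩
        ⋂ i ∈ Finset.Ico N n, (⋃ k₀ ∈ Finset.range (k + 1), ⋃ l ∈ (Finset.range (k + 1)).filter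
          (fun l => l ≤ k₀ + j i), firstBelow Y δ (a i) k₀ ∩ Y ((l : ℕ) * δ) ⁻¹' Iic (a (i + 1)))ᶜ := by
      ext ω
      rw [inter_comm]
      refine and_congr_right fun hk => ?_
      simp only [hD, mem_ofPred_eq, mem_iInter, mem_compl_iff]
      refine forall₂_congr fun i hi => not_congr ?_
      rw [Finset.mem_Ico] at hi
      have hkn := (mem_firstBelow.1 hk).1
      simp only [hH, mem_ofPred_eq, mem_iUnion, Finset.mem_range, Finset.mem_filter, exists_prop,
        mem_inter_iff, mem_preimage, mem_Iic]
      constructor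
      · rintro ⟨k₀, l, h1, h2, h3⟩
        obtain ⟨k₁, hk₁, h4⟩ := exists_mem_firstBelow_le (hkn.trans (ha hi.2.le))
        obtain rfl := firstBelow_unique h1 h4
        rcases le_total l k with hlk | hlk
        · exact ⟨k₀, by omega, l, ⟨by omega, h2⟩, h1, h3⟩
        · exact ⟨k₀, by omega, k, ⟨by omega, by omega⟩, h1, hkn.trans (ha (by omega))⟩
      · rintro ⟨k₀, -, l, ⟨-, h2⟩, h1, h3⟩
        exact ⟨k₀, l, h1, h2, h3⟩
    rw [heq]
    refine @MeasurableSet.inter _ (pastSigma Y (k * δ)) _ _ (measurableSet_firstBelow Y hδ.le le_rfl) ?_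
    refine @Finset.measurableSet_biInter _ _ (pastSigma Y (k * δ)) _ _ fun i _ => ?_
    refine @MeasurableSet.compl _ _ (pastSigma Y (k * δ)) ?_
    refine @Finset.measurableSet_biUnion _ _ (pastSigma Y (k * δ)) _ _ fun k₀ hk₀ => ?_
    refine @Finset.measurableSet_biUnion _ _ (pastSigma Y (k * δ)) _ _ fun l hl => ?_
    rw [Finset.mem_range] at hk₀
    rw [Finset.mem_filter, Finset.mem_range] at hl
    exact @MeasurableSet.inter _ (pastSigma Y (k * δ)) _ _
      (measurableSet_firstBelow Y hδ.le (by omega)) (hYm _ _ _ (by omega))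
  have hFm : ∀ n k, MeasurableSet (firstBelow Y δ (a n) k) := fun n k =>
    h.pastSigma_le _ _ (measurableSet_firstBelow Y hδ.le le_rfl)
  have hHm : ∀ n, MeasurableSet (H n) := by
    intro n
    have : H n = ⋃ k : ℕ, ⋃ l : ℕ, ⋃ _ : l ≤ k + j n,
        firstBelow Y δ (a n) k ∩ Y (l * δ) ⁻¹' Iic (a (n + 1)) := by
      ext ω
      simp only [hH, mem_ofPred_eq, mem_iUnion, mem_inter_iff, mem_preimage, mem_Iic, exists_prop]
      exact ⟨fun ⟨k, l, h1, h2, h3⟩ => ⟨k, l, h2, h1, h3⟩,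
        fun ⟨k, l, h2, h1, h3⟩ => ⟨k, l, h1, h2, h3⟩⟩
    rw [this]
    exact MeasurableSet.iUnion fun k => MeasurableSet.iUnion fun l => MeasurableSet.iUnion fun _ =>
      (hFm n k).inter (h.meas _ measurableSet_Iic)
  have hZm : ∀ n, MeasurableSet (Z n) := by
    intro n
    have : Z n = ⋃ k : ℕ, firstBelow Y δ (a (n + 1)) k ∩ {ω | Y (k * δ + ρ n) ω = 0} := by
      ext ω; simp [hZ]
    rw [this]
    exact MeasurableSet.iUnion fun k => (hFm _ k).inter (h.measurableSet_zero _)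
  have hZle : ∀ n, P.real (Z n)ᶜ ≤ 1 - Real.exp (-(a (n + 1) * q (ρ n))) := by
    intro n
    have h1 := h.exp_mul_le_real_inter_firstBelow hδ.le (hρ n) (hq _ (hρ n)).le (D := univ)
      (fun k => by rw [univ_inter]; exact measurableSet_firstBelow Y hδ.le le_rfl) (hcov (n + 1))
    rw [probReal_univ, mul_one, univ_inter] at h1
    rw [probReal_compl_eq_one_sub (hZm n)]
    linarith
  have hDle : ∀ n, N ≤ n → P.real (D n) ≤ ∏ i ∈ Finset.Ico N n, (1 - Real.exp (-(a i * q (s i)))) := by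
    intro n hn
    induction n, hn using Nat.le_induction with
    | base => simp [measureReal_le_one]
    | succ n hn ih =>
      rw [Finset.prod_Ico_succ_top hn]
      have h1 := h.exp_mul_le_real_inter_firstBelow hδ.le (hs n) (hq _ (hs n)).le (hDF n) (hcov n)
      have h2 : P.real (D n ∩ {ω | ∃ k : ℕ, ω ∈ firstBelow Y δ (a n) k ∧
          Y (k * δ + s n) ω = 0}) ≤ P.real (D n ∩ H n) := by
        refine ENNReal.toReal_mono (measure_ne_top _ _) (measure_mono_ae ?_)
        filter_upwards [habs] with ω hω
        rintro ⟨h3, k, hk, hk0⟩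
        have hsn := (hs n).le
        refine ⟨h3, k, k + j n, hk, le_rfl, ?_⟩
        rw [hω (k * δ + s n) _ (by positivity) (by push_cast; linarith [hj1 n]) hk0]
        exact ha0 _
      have h3 : P.real (D (n + 1)) ≤ P.real (D n \ H n) := by
        refine measureReal_mono fun ω hω => ⟨fun i hi => hω i ?_, hω n ?_⟩
        · rw [Finset.mem_Ico] at hi ⊢; omega
        · rw [Finset.mem_Ico]; omega
      have h4 := measureReal_sdiff_add_inter (μ := P) (s := D n) (hHm n)
      have h5 : Real.exp (-(a n * q (s n))) ≤ 1 := by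
        rw [Real.exp_le_one_iff]
        have := mul_nonneg (ha0 n) (hq _ (hs n)).le
        linarith
      calc _ ≤ P.real (D n) * (1 - Real.exp (-(a n * q (s n)))) := by linarith
        _ ≤ _ := mul_le_mul_of_nonneg_right ih (by linarith)
  calc _ ≤ P.real (D M ∪ ⋃ n ∈ Finset.Ico N M, (Z n)ᶜ) := by
        refine ENNReal.toReal_mono (measure_ne_top _ _) (measure_mono_ae ?_)
        filter_upwards [habs, hY0, ae_all_iff.2 hcov] with ω hω hω0 hωc hωG
        by_contra hcon
        obtain ⟨h1, h2⟩ := not_or.1 hcon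
        obtain ⟨n, hn, hHn⟩ : ∃ n, ∃ _ : n ∈ Finset.Ico N M, ω ∈ H n := by
          by_contra! hno
          exact h1 hno
        obtain ⟨k, l, hk, hl, hla⟩ := hHn
        obtain ⟨k', hk', hk0⟩ : ω ∈ Z n := by
          by_contra hno
          exact h2 (mem_iUnion₂.2 ⟨n, hn, hno⟩)
        obtain ⟨l', hl', hll'⟩ := exists_mem_firstBelow_le hla
        obtain rfl := firstBelow_unique hk' hll'
        have hn' := Finset.mem_Ico.1 hn
        have hkpos : k ≠ 0 := by
          rintro rfl
          have h3 := (mem_firstBelow.1 hk).1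
          rw [Nat.cast_zero, zero_mul] at h3
          linarith [ha hn'.1]
        obtain ⟨k, rfl⟩ := Nat.exists_eq_succ_of_ne_zero hkpos
        refine hωG n hn ⟨k * δ, by positivity, (mem_firstBelow.1 hk).2 k (Nat.lt_succ_self k), ?_⟩
        have hρn := (hρ n).le
        refine hω (k' * δ + ρ n) _ (by positivity) ?_ hk0
        have h4 : (k' : ℝ) ≤ k + 1 + j n := by exact_mod_cast hl'.trans hl
        have h5 : (k' : ℝ) * δ ≤ (k + 1 + j n) * δ := by gcongr
        linarith [hj2 n, hδρ n hn]
    _ ≤ P.real (D M) + P.real (⋃ n ∈ Finset.Ico N M, (Z n)ᶜ) := measureReal_union_le _ _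
    _ ≤ _ := by
        refine add_le_add (hDle M hNM) ((measureReal_biUnion_finset_le _ _).trans ?_)
        exact Finset.sum_le_sum fun n _ => hZle n

end HasExtinctionLaw

lemma prod_Ico_one_sub_inv {N M : ℕ} (hNM : N ≤ M) :
    ∏ n ∈ Finset.Ico N M, (1 - ((n : ℝ) + 2)⁻¹) = (N + 1) / (M + 1) := by
  induction M, hNM using Nat.le_induction with
  | base => rw [Finset.Ico_self, Finset.prod_empty, div_self (by positivity)]
  | succ M hM ih =>
    rw [Finset.prod_Ico_succ_top hM, ih]
    push_cast
    field_simp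
    ring

lemma sum_Ico_inv_sq_le {N M : ℕ} (hN : 1 ≤ N) (hNM : N ≤ M) :
    ∑ n ∈ Finset.Ico N M, (((n : ℝ) + 1) ^ 2)⁻¹ ≤ (N : ℝ)⁻¹ - (M : ℝ)⁻¹ := by
  induction M, hNM using Nat.le_induction with
  | base => simp
  | succ M hM ih =>
    rw [Finset.sum_Ico_succ_top hM]
    have hM0 : (0 : ℝ) < M := by exact_mod_cast (by omega : 0 < M)
    have h1 : (((M : ℝ) + 1) ^ 2)⁻¹ ≤ (M : ℝ)⁻¹ - ((M : ℝ) + 1)⁻¹ := by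
      rw [inv_sub_inv hM0.ne' (by positivity), add_sub_cancel_left, inv_eq_one_div]
      gcongr
      nlinarith
    push_cast
    linarith

lemma ae_frequently_fast_extinction {P : Measure Ω} [IsProbabilityMeasure P] {Y : ℝ → Ω → ℝ}
    {φ q : ℝ → ℝ} (h : HasExtinctionLaw P Y q) (hφ : DecreasingInverses φ q)
    (hex : ∀ᵐ ω ∂P, ∃ t, 0 ≤ t ∧ Y t ω = 0) {x : ℝ} (hx : 0 < x) (hY0 : ∀ᵐ ω ∂P, Y 0 ω = x) :
    ∀ᵐ ω ∂P, ∃ᶠ n : ℕ in atTop, ∃ r, 0 ≤ r ∧ ((n.factorial : ℝ) ^ 4)⁻¹ < Y r ω ∧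
      Y (r + (φ (Real.log (n + 2) * n.factorial ^ 4) +
        2 * φ ((n + 1) ^ 2 * n.factorial ^ 4))) ω = 0 := by
  set a : ℕ → ℝ := fun n => ((n.factorial : ℝ) ^ 4)⁻¹ with ha
  set G : ℕ → Set Ω := fun n => {ω | ∃ r, 0 ≤ r ∧ a n < Y r ω ∧
    Y (r + (φ (Real.log (n + 2) * n.factorial ^ 4) +
        2 * φ ((n + 1) ^ 2 * n.factorial ^ 4))) ω = 0} with hG
  have hfac : ∀ n : ℕ, (0 : ℝ) < n.factorial := fun n => by exact_mod_cast n.factorial_pos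
  have hlog : ∀ n : ℕ, 0 < Real.log ((n : ℝ) + 2) := fun n =>
    Real.log_pos (by have : (0 : ℝ) ≤ n := n.cast_nonneg; linarith)
  have hanti : Antitone a := by
    intro m n hmn
    have : (m.factorial : ℝ) ≤ n.factorial := by exact_mod_cast Nat.factorial_le hmn
    have := hfac m
    simp only [ha]
    gcongr
  have hu : ∀ n : ℕ, 0 < Real.log ((n : ℝ) + 2) * n.factorial ^ 4 := fun n =>
    mul_pos (hlog n) (pow_pos (hfac n) 4)
  have hv : ∀ n : ℕ, (0 : ℝ) < ((n : ℝ) + 1) ^ 2 * n.factorial ^ 4 := fun n =>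
    mul_pos (by positivity) (pow_pos (hfac n) 4)
  have hfactop : Tendsto (fun n : ℕ => (n.factorial : ℝ)) atTop atTop :=
    tendsto_natCast_atTop_atTop.comp factorial_tendsto_atTop
  have hsmall : ∀ᶠ n in atTop, a n < x :=
    (tendsto_inv_atTop_zero.comp ((tendsto_pow_atTop (by norm_num)).comp hfactop)).eventually_lt_const hx
  have hbound : ∀ᶠ N : ℕ in atTop, P.real {ω | ∀ n, N ≤ n → ω ∉ G n} ≤ (N : ℝ)⁻¹ := by
    filter_upwards [hsmall, eventually_ge_atTop 1] with N hN hN1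
    have hM : ∀ᶠ M : ℕ in atTop, P.real {ω | ∀ n, N ≤ n → ω ∉ G n} ≤
        (N + 1) / ((M : ℝ) + 1) + (N : ℝ)⁻¹ := by
      filter_upwards [eventually_ge_atTop N] with M hNM
      have key := h.real_not_fast_extinction_le hφ.pos_right
        (fun s t hs hst => hφ.symm.le_of_le hs hst) hex hanti
        (fun n => by simp only [ha]; positivity)
        (s := fun n => φ (Real.log (n + 2) * n.factorial ^ 4))
        (ρ := fun n => φ ((n + 1) ^ 2 * n.factorial ^ 4))
        (fun n => hφ.pos_left _ (hu n)) (fun n => hφ.pos_left _ (hv n)) hNM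
        (hY0.mono fun ω hω => by rw [hω]; exact hN)
      refine le_trans ?_ (key.trans (add_le_add (le_of_eq ?_) ?_))
      · refine measureReal_mono fun ω hω n hn => ?_
        have h1 : ∀ n, N ≤ n → ω ∉ G n := hω
        exact h1 n (Finset.mem_Ico.1 hn).1
      · rw [← prod_Ico_one_sub_inv hNM]
        refine Finset.prod_congr rfl fun n _ => ?_
        have h4 := pow_pos (hfac n) 4
        rw [hφ.inv_left _ (hu n), show a n * (Real.log (n + 2) * n.factorial ^ 4) =
          Real.log ((n : ℝ) + 2) by simp only [ha]; field_simp, Real.exp_neg,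
          Real.exp_log (by positivity)]
      · refine le_trans (Finset.sum_le_sum fun n _ => ?_)
          ((sum_Ico_inv_sq_le hN1 hNM).trans (sub_le_self _ (by positivity)))
        have h4 := hfac n
        rw [hφ.inv_left _ (hv n), show a (n + 1) * (((n : ℝ) + 1) ^ 2 * n.factorial ^ 4) =
          (((n : ℝ) + 1) ^ 2)⁻¹ by
            simp only [ha, Nat.factorial_succ]; push_cast; field_simp]
        linarith [Real.add_one_le_exp (-(((n : ℝ) + 1) ^ 2)⁻¹)]
    have hlim : Tendsto (fun M : ℕ => ((N : ℝ) + 1) / ((M : ℝ) + 1) + (N : ℝ)⁻¹) atTop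
        (𝓝 (0 + (N : ℝ)⁻¹)) :=
      (tendsto_const_nhds.div_atTop
        (tendsto_atTop_add_const_right _ _ tendsto_natCast_atTop_atTop)).add_const _
    rw [zero_add] at hlim
    exact ge_of_tendsto hlim hM
  have hnull : ∀ K : ℕ, ∀ᵐ ω ∂P, ω ∉ {ω | ∀ n, K ≤ n → ω ∉ G n} := by
    intro K
    refine measure_eq_zero_iff_ae_notMem.1 ?_
    rw [← measureReal_eq_zero_iff]
    refine le_antisymm (ge_of_tendsto tendsto_inv_atTop_nhds_zero_nat ?_) measureReal_nonneg
    filter_upwards [hbound, eventually_ge_atTop K] with N hN hKN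
    exact (measureReal_mono fun ω (hω : ∀ n, K ≤ n → ω ∉ G n) n hn =>
      hω n (hKN.trans hn)).trans hN
  filter_upwards [ae_all_iff.2 hnull] with ω hω
  refine frequently_atTop.2 fun K => ?_
  by_contra! hcon
  exact hω K fun n hn => fun ⟨r, hr, h1, h2⟩ => hcon n hn r hr h1 h2

end Probability

section Paths

variable {f fleft φ q : ℝ → ℝ} {T θ : ℝ}

lemma log_log_mul_le {z w : ℝ} (hz : Real.exp 1 ≤ Real.log z) (hzw : z ≤ w) (hz0 : 0 < z) :
    Real.log (Real.log w) * z ≤ Real.log (Real.log z) * w := by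
  have hz1 : 1 ≤ Real.log z := (Real.one_le_exp zero_le_one).trans hz
  have hw0 : 0 < w := hz0.trans_le hzw
  have hlw : Real.log z ≤ Real.log w := Real.log_le_log hz0 hzw
  have hll : 1 ≤ Real.log (Real.log z) := by
    rw [Real.le_log_iff_exp_le (by linarith)]; exact hz
  have h1 : Real.log w - Real.log z ≤ w / z - 1 := by
    rw [← Real.log_div hw0.ne' hz0.ne']
    exact Real.log_le_sub_one_of_pos (by positivity)
  have h2 : Real.log (Real.log w) - Real.log (Real.log z) ≤ Real.log w / Real.log z - 1 := by
    rw [← Real.log_div (by linarith) (by linarith)]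
    exact Real.log_le_sub_one_of_pos (div_pos (by linarith) (by linarith))
  have h3 : Real.log w / Real.log z - 1 ≤ Real.log w - Real.log z := by
    rw [div_sub_one (by linarith)]
    exact div_le_self (by linarith) hz1
  have hwz : 1 ≤ w / z := by rwa [le_div_iff₀ hz0, one_mul]
  have h4 : Real.log (Real.log w) ≤ Real.log (Real.log z) * (w / z) := by nlinarith
  calc _ ≤ Real.log (Real.log z) * (w / z) * z := by gcongr
    _ = _ := by field_simp

lemma tendsto_log_mul_factorial :
    Tendsto (fun n : ℕ => Real.log ((n : ℝ) + 2) * (n.factorial : ℝ) ^ 4) atTop atTop := by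
  have h1 : Tendsto (fun n : ℕ => Real.log ((n : ℝ) + 2)) atTop atTop :=
    Real.tendsto_log_atTop.comp (tendsto_atTop_add_const_right _ _ tendsto_natCast_atTop_atTop)
  have h2 : Tendsto (fun n : ℕ => (n.factorial : ℝ) ^ 4) atTop atTop :=
    (tendsto_pow_atTop (by norm_num)).comp
      (tendsto_natCast_atTop_atTop.comp factorial_tendsto_atTop)
  exact h1.atTop_mul_atTop₀ h2

lemma eventually_log_log_le (hθ0 : 0 < θ) (hθ1 : θ < 1) :
    ∀ᶠ n : ℕ in atTop, Real.log (Real.log (Real.log ((n : ℝ) + 2) * (n.factorial : ℝ) ^ 4)) ≤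
      θ⁻¹ * Real.log ((n : ℝ) + 2) := by
  have hθ : 0 < (θ⁻¹ - 1) / 2 := by linarith [(one_lt_inv₀ hθ0).2 hθ1]
  have h1 : Tendsto (fun n : ℕ => Real.log ((n : ℝ) + 2)) atTop atTop :=
    Real.tendsto_log_atTop.comp (tendsto_atTop_add_const_right _ _ tendsto_natCast_atTop_atTop)
  have hsmall := h1.eventually (Real.isLittleO_log_id_atTop.bound hθ)
  filter_upwards [hsmall, (h1.const_mul_atTop hθ).eventually_ge_atTop (Real.log 5),
    h1.eventually_ge_atTop 1,
    tendsto_log_mul_factorial.eventually_ge_atTop (Real.exp 1)] with n h2 h3 h4 h5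
  have hn : (0 : ℝ) < (n : ℝ) + 2 := by positivity
  simp only [id, Real.norm_eq_abs, abs_of_nonneg (zero_le_one.trans h4)] at h2
  have h6 := (le_abs_self _).trans h2
  have hfac : (0 : ℝ) < n.factorial := by exact_mod_cast n.factorial_pos
  have hfle : Real.log (n.factorial : ℝ) ≤ n * Real.log ((n : ℝ) + 2) := by
    rw [← Real.log_pow]
    refine Real.log_le_log hfac ?_
    calc (n.factorial : ℝ) ≤ (n : ℝ) ^ n := by exact_mod_cast n.factorial_le_pow
      _ ≤ _ := by gcongr; linarith
  have h7 : Real.log (Real.log ((n : ℝ) + 2) * (n.factorial : ℝ) ^ 4) ≤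
      5 * ((n : ℝ) + 2) * Real.log ((n : ℝ) + 2) := by
    rw [Real.log_mul (by linarith) (by positivity), Real.log_pow]
    have h8 : Real.log (Real.log ((n : ℝ) + 2)) ≤ Real.log ((n : ℝ) + 2) :=
      Real.log_le_self (by linarith)
    have hn0 : (0 : ℝ) ≤ n := n.cast_nonneg
    push_cast
    nlinarith
  have h8 : 1 ≤ Real.log (Real.log ((n : ℝ) + 2) * (n.factorial : ℝ) ^ 4) := by
    rw [Real.le_log_iff_exp_le ((Real.exp_pos 1).trans_le h5)]; exact h5
  refine (Real.log_le_log (by linarith) h7).trans ?_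
  rw [Real.log_mul (by positivity) (by linarith), Real.log_mul (by norm_num) (by positivity)]
  linarith

lemma eventually_add_tail_le (hR : RegularTail φ q) (hθ0 : 0 < θ) (hθ1 : θ < 1) :
    ∀ᶠ n : ℕ in atTop, φ (Real.log (n + 2) * n.factorial ^ 4) +
      2 * φ ((n + 1) ^ 2 * n.factorial ^ 4) ≤ φ (θ * (Real.log (n + 2) * n.factorial ^ 4)) := by
  obtain ⟨κ, hκ, hgap⟩ := hR.gap θ hθ0 hθ1
  obtain ⟨R, hR1, hle⟩ := hR.exists_le_mul_of_mul_le (half_pos hκ)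
  filter_upwards [tendsto_log_mul_factorial.eventually_ge_atTop 1,
    (tendsto_log_mul_factorial.const_mul_atTop hθ0).eventually_ge_atTop 1,
    tendsto_natCast_atTop_atTop.eventually_ge_atTop R] with n h1 h2 h3
  have hlog : Real.log ((n : ℝ) + 2) ≤ n + 1 := by
    linarith [Real.log_le_sub_one_of_pos (by positivity : (0 : ℝ) < (n : ℝ) + 2)]
  have h4 := hle _ (((n : ℝ) + 1) ^ 2 * n.factorial ^ 4) h1 (by
    rw [← mul_assoc]
    gcongr
    have hlog0 : 0 ≤ Real.log ((n : ℝ) + 2) :=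
      Real.log_nonneg (by linarith [n.cast_nonneg (α := ℝ)])
    calc R * Real.log ((n : ℝ) + 2) ≤ (n + 1) * (n + 1) := by
          gcongr
          linarith
      _ = _ := by ring)
  linarith [hgap _ h2]

lemma frequently_le_left_limit (hR : RegularTail φ q) (hspec : ∀ s, 0 ≤ s → (f s = 0 ↔ T ≤ s))
    (hright : ∀ t, 0 ≤ t → ContinuousWithinAt f (Ici t) t)
    (hleft : ∀ s, 0 < s → Tendsto f (𝓝[<] s) (𝓝 (fleft s))) (hθ0 : 0 < θ) (hθ1 : θ < 1)
    (hfreq : ∃ᶠ n : ℕ in atTop, ∃ r, 0 ≤ r ∧ ((n.factorial : ℝ) ^ 4)⁻¹ < f r ∧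
      f (r + (φ (Real.log (n + 2) * n.factorial ^ 4) +
        2 * φ ((n + 1) ^ 2 * n.factorial ^ 4))) = 0) :
    ∃ᶠ t in 𝓝[>] (0 : ℝ), θ ^ 2 ≤ fleft (T - t) * q t / Real.log (Real.log (q t)) := by
  have hz : Tendsto (fun n : ℕ => θ * (Real.log ((n : ℝ) + 2) * (n.factorial : ℝ) ^ 4)) atTop atTop :=
    tendsto_log_mul_factorial.const_mul_atTop hθ0
  rw [(nhdsGT_basis (0 : ℝ)).frequently_iff]
  intro ε hε
  obtain ⟨n, ⟨r, hr, hfr, hfr0⟩, h1, h2, h3, h4, h5, h6⟩ := (hfreq.and_eventually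
    ((eventually_add_tail_le hR hθ0 hθ1).and ((eventually_log_log_le hθ0 hθ1).and
      (((hR.tendsto_atTop.comp hz).eventually_lt_const hε).and
        ((hz.eventually_gt_atTop 0).and
          (((Real.tendsto_log_atTop.comp hz).eventually_ge_atTop (Real.exp 1)).and
            (tendsto_log_mul_factorial.eventually_gt_atTop 0))))))).exists
  simp only [Function.comp_apply] at h3 h5
  set u := Real.log ((n : ℝ) + 2) * (n.factorial : ℝ) ^ 4 with hu
  set τ := φ u + 2 * φ (((n : ℝ) + 1) ^ 2 * n.factorial ^ 4) with hτ
  have hfac : (0 : ℝ) < (n.factorial : ℝ) ^ 4 := by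
    have : (0 : ℝ) < n.factorial := by exact_mod_cast n.factorial_pos
    positivity
  have hτ0 : 0 < τ := by
    have := hR.pos_left u h6
    have := hR.pos_left (((n : ℝ) + 1) ^ 2 * n.factorial ^ 4) (by positivity)
    positivity
  have hrT : r < T := by
    by_contra! hle
    have h7 := (hspec r hr).2 hle
    rw [h7] at hfr
    exact absurd hfr (not_lt.2 (inv_pos.2 hfac).le)
  have hTr : T ≤ r + τ := (hspec _ (by linarith)).1 hfr0
  obtain ⟨r', hr', hIoo⟩ : ∃ r' ∈ Ioo r T, ∀ s ∈ Ioo r r', ((n.factorial : ℝ) ^ 4)⁻¹ < f s := by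
    have hev := (hright r hr).eventually_const_lt hfr
    obtain ⟨b, hb, hsub⟩ := mem_nhdsGE_iff_exists_Ico_subset.1 hev
    refine ⟨min b ((r + T) / 2), ⟨lt_min hb (by linarith), (min_le_right _ _).trans_lt (by linarith)⟩,
      fun s hs => hsub ⟨hs.1.le, hs.2.trans_le (min_le_left _ _)⟩⟩
  have hfl : ((n.factorial : ℝ) ^ 4)⁻¹ ≤ fleft r' := by
    refine ge_of_tendsto (hleft r' (hr.trans_lt hr'.1)) ?_
    filter_upwards [Ioo_mem_nhdsLT hr'.1] with s hs using (hIoo s hs).le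
  have ht0 : 0 < T - r' := by linarith [hr'.2]
  have htτ : T - r' < φ (θ * u) := by linarith [hr'.1]
  refine ⟨T - r', ⟨ht0, htτ.trans h3⟩, ?_⟩
  rw [sub_sub_cancel]
  have hqt : θ * u ≤ q (T - r') := by
    have := hR.symm.le_of_le ht0 htτ.le
    rwa [hR.inv_left _ h4] at this
  have hq0 := h4.trans_le hqt
  have hmul := log_log_mul_le h5 hqt h4
  have hlz : Real.log (Real.log (θ * u)) ≤ θ⁻¹ * Real.log ((n : ℝ) + 2) := by
    refine le_trans (Real.log_le_log ((Real.exp_pos 1).trans_le h5) (Real.log_le_log h4 ?_)) h2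
    nlinarith
  have hllw : 0 < Real.log (Real.log (q (T - r'))) := by
    have h7 : Real.exp 1 ≤ Real.log (q (T - r')) := h5.trans (Real.log_le_log h4 hqt)
    exact Real.log_pos ((Real.one_lt_exp_iff.2 one_pos).trans_le h7)
  rw [le_div_iff₀ hllw]
  have hlogpos : 0 < Real.log ((n : ℝ) + 2) := pos_of_mul_pos_left h6 hfac.le
  have h8 : Real.log (Real.log (q (T - r'))) * (θ * u) ≤
      θ⁻¹ * Real.log ((n : ℝ) + 2) * q (T - r') := hmul.trans (by gcongr)
  have h9 : θ ^ 2 * Real.log (Real.log (q (T - r'))) ≤ ((n.factorial : ℝ) ^ 4)⁻¹ * q (T - r') := by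
    have h10 : θ ^ 2 * Real.log (Real.log (q (T - r'))) * (θ⁻¹ * u) =
        Real.log (Real.log (q (T - r'))) * (θ * u) := by field_simp
    have h11 : ((n.factorial : ℝ) ^ 4)⁻¹ * q (T - r') * (θ⁻¹ * u) =
        θ⁻¹ * Real.log ((n : ℝ) + 2) * q (T - r') := by rw [hu]; field_simp
    refine le_of_mul_le_mul_right ?_ (mul_pos (inv_pos.2 hθ0) h6)
    rw [h10, h11]
    exact h8
  exact h9.trans (by gcongr)

/-- A limit superior is determined by asymptotic upper bounds together with frequent lower
bounds. -/
lemma limsup_eq_one_of_bounds {g : ℝ → ℝ} {l : Filter ℝ}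
    (hup : ∀ n : ℕ, ∀ᶠ t in l, g t ≤ (1 + ((n : ℝ) + 1)⁻¹) ^ 5)
    (hlow : ∀ n : ℕ, ∃ᶠ t in l, (1 - ((n : ℝ) + 2)⁻¹) ^ 2 ≤ g t) : limsup g l = 1 := by
  have hbdd : IsBoundedUnder (· ≤ ·) l g := isBoundedUnder_of_eventually_le (hup 0)
  have hcobdd : IsCoboundedUnder (· ≤ ·) l g := IsCoboundedUnder.of_frequently_ge (hlow 0)
  have hinv : ∀ c : ℝ, Tendsto (fun n : ℕ => ((n : ℝ) + c)⁻¹) atTop (𝓝 0) := fun c =>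
    tendsto_inv_atTop_zero.comp (tendsto_atTop_add_const_right _ _ tendsto_natCast_atTop_atTop)
  refine le_antisymm ?_ ?_
  · have hlim : Tendsto (fun n : ℕ => (1 + ((n : ℝ) + 1)⁻¹) ^ 5) atTop (𝓝 1) := by
      simpa using ((hinv 1).const_add 1).pow 5
    exact ge_of_tendsto' hlim fun n => limsup_le_of_le hcobdd (hup n)
  · have hlim : Tendsto (fun n : ℕ => (1 - ((n : ℝ) + 2)⁻¹) ^ 2) atTop (𝓝 1) := by
      simpa using ((hinv 2).const_sub 1).pow 2
    exact le_of_tendsto' hlim fun n => le_limsup_of_frequently_le (hlow n) hbdd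

end Paths

theorem LIL_near_extinction
    (ψ : ℝ → ℝ) (a b : ℝ) (hb : 0 ≤ b) (ν : Measure ℝ)
    (hνsupp : ν (Set.Iic 0) = 0)
    (hνint : ∫⁻ x, ENNReal.ofReal (min 1 (x ^ 2)) ∂ν ≠ ⊤)
    (hψform : ∀ l : ℝ, 0 ≤ l →
      ψ l = a * l + b * l ^ 2 +
        ∫ x, (Real.exp (-l * x) - 1 + l * x * Set.indicator (Set.Iio 1) (fun _ => (1 : ℝ)) x) ∂ν)
    (hψpos : ∀ u : ℝ, 0 < u → 0 < ψ u)
    (hGrey : ∀ t : ℝ, 0 < t → IntegrableOn (fun u => (ψ u)⁻¹) (Set.Ioi t))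
    (hdiv : ¬ IntegrableOn (fun u => (ψ u)⁻¹) (Set.Ioc 0 1))
    (φ : ℝ → ℝ)
    (hφ : ∀ t : ℝ, 0 < t → φ t = ∫ u in Set.Ioi t, (ψ u)⁻¹)
    (hφanti : StrictAntiOn φ (Set.Ioi 0))
    (hφcont : ContinuousOn φ (Set.Ioi 0))
    (hφbij : Set.BijOn φ (Set.Ioi 0) (Set.Ioi 0))
    (φinv : ℝ → ℝ)
    (hφinvpos : ∀ s : ℝ, 0 < s → 0 < φinv s)
    (hinvl : ∀ t : ℝ, 0 < t → φinv (φ t) = t)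
    (hinvr : ∀ s : ℝ, 0 < s → φ (φinv s) = s)
    (hδ : 1 < sSup {c : ℝ | 0 ≤ c ∧ ∃ Q : ℝ, 0 < Q ∧
      ∀ u v : ℝ, 1 ≤ u → u ≤ v → Q * ψ u * u ^ (-c) ≤ ψ v * v ^ (-c)})
    (x : ℝ) (hx : 0 < x)
    {Ω : Type*} [MeasurableSpace Ω] (P : Measure Ω) [IsProbabilityMeasure P]
    (Y : ℝ → Ω → ℝ) (hYmeas : ∀ t : ℝ, Measurable (Y t))
    (hYnonneg : ∀ t : ℝ, 0 ≤ t → ∀ ω, 0 ≤ Y t ω)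
    (hYright : ∀ ω, ∀ t : ℝ, 0 ≤ t → ContinuousWithinAt (fun s => Y s ω) (Set.Ici t) t)
    (hY0 : ∀ᵐ ω ∂P, Y 0 ω = x)
    (hMarkov : ∀ s t : ℝ, 0 ≤ s → 0 ≤ t → ∀ lam : ℝ, 0 < lam →
      P[(fun ω => Real.exp (-lam * Y (t + s) ω)) |
          ⨆ u ∈ Set.Icc (0 : ℝ) t, MeasurableSpace.comap (Y u) inferInstance]
        =ᵐ[P] fun ω => Real.exp (-(Y t ω) * φinv (s + φ lam)))
    (Yleft : ℝ → Ω → ℝ)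
    (hYleft : ∀ ω, ∀ s : ℝ, 0 < s →
      Tendsto (fun u => Y u ω) (𝓝[<] s) (nhds (Yleft s ω))) :
    ∀ᵐ ω ∂P,
      (∃ t : ℝ, 0 ≤ t ∧ Y t ω = 0) ∧
      Filter.limsup (fun t : ℝ =>
          Yleft (sInf {s : ℝ | 0 ≤ s ∧ Y s ω = 0} - t) ω *
            φinv t / Real.log (Real.log (φinv t)))
        (𝓝[>] (0 : ℝ)) = 1 := by
  obtain ⟨c, ⟨-, Q, hQ, hgrow⟩, hc⟩ := exists_lt_of_lt_csSup (by
    by_contra! hne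
    rw [hne, Real.sSup_empty] at hδ
    linarith) hδ
  have hR : RegularTail φ φinv := by
    obtain ⟨K, hK, hψ4⟩ := branchingMechanism_two_mul_le hνsupp hνint hψform
    obtain ⟨C, -, hψ2⟩ := exists_two_mul_le_of_growth (hψpos 1 one_pos) hK hψ4 hc hQ hgrow
    exact
      { anti := hφanti
        pos_left := fun t ht => hφbij.mapsTo ht
        pos_right := hφinvpos
        inv_left := hinvl
        inv_right := hinvr
        gap := fun θ hθ0 hθ1 => exists_one_add_mul_le_tail hψpos hGrey hφ hc hQ hgrow hθ0 hθ1
        doubling := ⟨C, fun u hu => tail_half_le hψpos hGrey hφ hψ2 hu⟩ }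
  have hD := hR.toDecreasingInverses
  have hE : HasExtinctionLaw P Y φinv :=
    hasExtinctionLaw_of_condExp hD hYmeas hYnonneg hYright hMarkov
  have hex := hE.ae_exists_zero hY0 hD.symm.tendsto_atTop
  have hρ : ∀ n : ℕ, 1 < 1 + ((n : ℝ) + 1)⁻¹ := fun n => lt_add_of_pos_right _ (by positivity)
  filter_upwards [hex, hY0, hE.ae_absorbed hD.pos_right fun s t hs hst => hD.symm.le_of_le hs hst,
    ae_frequently_fast_extinction hE hD hex hx hY0,
    ae_all_iff.2 fun n : ℕ => ae_eventually_not_large_before_extinction hE hR (hρ n)]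
    with ω hω hω0 habs hfreq hev
  obtain ⟨hT, hspec⟩ := extinctionTime_spec (hYright ω) habs hω (by rw [hω0]; exact hx.ne')
  refine ⟨hω, limsup_eq_one_of_bounds (fun n => ?_) fun n => ?_⟩
  · exact eventually_left_limit_le hD hT hspec (hYleft ω) (hρ n) (hev n)
  · have hn : (1 : ℝ) < (n : ℝ) + 2 := by linarith [n.cast_nonneg (α := ℝ)]
    exact frequently_le_left_limit hR hspec (hYright ω) (hYleft ω)
      (sub_pos.2 (inv_lt_one_of_one_lt₀ hn)) (sub_lt_self _ (by positivity)) hfreq
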